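/- Let η > 0 and δ > 0 satisfy K/(R(d−1)) − (R+1) > δ/η. Then there is a constant c depending only on n, R, d, η, δ (not on C̃) such that the singular integral satisfies |J(μ)| ≤ c C̃^{R(R−1)} for all μ ∈ ℝ^R. -/

import Mathlib

open MeasureTheory Filter MvPolynomial

noncomputable section

/-- `e t = exp (2 π i t)` -/
def eC (t : ℝ) : ℂ := Complex.exp (2 * (Real.pi : ℂ) * Complex.I * (t : ℂ))

abbrev Qbar : Type := AlgebraicClosure ℚ

/-- Dimension of the affine singular locus of `g` (the common zero set of the partial
derivatives of `g`), as the Krull dimension of its coordinate ring. -/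
def singDim (n : ℕ) (g : MvPolynomial (Fin n) Qbar) : WithBot ℕ∞ :=
  ringKrullDim (MvPolynomial (Fin n) Qbar ⧸
    Ideal.span (Set.range fun j : Fin n => MvPolynomial.pderiv j g))

/-- `Δ = max_{b ∈ ℤ^R \ {0}} dim Sing(b₁ g₁ + ⋯ + b_R g_R)`. -/
def birchDelta (n R : ℕ) (g : Fin R → MvPolynomial (Fin n) ℤ) : WithBot ℕ∞ :=
  ⨆ (b : Fin R → ℤ) (_ : b ≠ 0),
    singDim n (MvPolynomial.map (Int.castRingHom Qbar) (∑ i, b i • g i))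

/-- `K = (n - Δ)/2^(d-1)` where `Δ = max_{b ≠ 0} dim Sing(f̃_b)`. -/
def KofDelta (n R d : ℕ) (g : Fin R → MvPolynomial (Fin n) ℤ) (K : ℝ) : Prop :=
  ∃ Δ : ℕ, ((Δ : ℕ∞) : WithBot ℕ∞) = birchDelta n R g ∧
    K = ((n : ℝ) - (Δ : ℝ)) / 2 ^ (d - 1)

/-- The quantity `R(R+1)(d-1)` as a real number. -/
def BB (R d : ℕ) : ℝ := (R : ℝ) * ((R : ℝ) + 1) * ((d : ℝ) - 1)

/-- The `R × R` minor of the Jacobian matrix of `f` with columns given by the elements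
of `I`. -/
def jacMinor {n R : ℕ} (f : Fin R → MvPolynomial (Fin n) ℤ)
    (I : Finset (Fin n)) (hI : I.card = R) : MvPolynomial (Fin n) ℤ :=
  Matrix.det (Matrix.of fun i k : Fin R => MvPolynomial.pderiv (I.orderEmbOfFin hI k) (f i))

/-- `Cv` is the maximum of the absolute values of the coefficients of the `f i`. -/
def coeffMax {n R : ℕ} (f : Fin R → MvPolynomial (Fin n) ℤ) (Cv : ℝ) : Prop :=
  IsGreatest {x : ℝ | ∃ (i : Fin R) (m : (Fin n) →₀ ℕ), x = |((MvPolynomial.coeff m (f i) : ℤ) : ℝ)|} Cv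

/-- The integer points of the dilated box `P𝓑`. -/
def boxPts {n : ℕ} (aB bB : Fin n → ℝ) (P : ℝ) : Finset (Fin n → ℤ) :=
  Finset.Icc (fun j => ⌈P * aB j⌉) (fun j => ⌊P * bB j⌋)

/-- The exponential sum `S(α) = ∑_{x ∈ P𝓑 ∩ ℤ^n} e(α · f(x))`. -/
def Sexp {n R : ℕ} (f : Fin R → MvPolynomial (Fin n) ℤ) (aB bB : Fin n → ℝ) (P : ℝ)
    (α : Fin R → ℝ) : ℂ :=
  ∑ x ∈ boxPts aB bB P, eC (∑ i, α i * (MvPolynomial.eval x (f i) : ℝ))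

/-- The complete exponential sum `S_{a,q} = ∑_{x mod q} e(a · f(x)/q)`. -/
def Sgauss {n R : ℕ} (f : Fin R → MvPolynomial (Fin n) ℤ) (q : ℕ) (a : Fin R → ℤ) : ℂ :=
  ∑ x : Fin n → Fin q,
    eC ((∑ i, (a i : ℝ) * (MvPolynomial.eval (fun j => ((x j : ℕ) : ℤ)) (f i) : ℝ)) / q)

/-- `S_{a,q}(ν) = S_{a,q} e(-a·ν/q)`. -/
def SgaussNu {n R : ℕ} (f : Fin R → MvPolynomial (Fin n) ℤ) (q : ℕ) (a : Fin R → ℤ)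
    (ν : Fin R → ℤ) : ℂ :=
  Sgauss f q a * eC (-(∑ i, (a i : ℝ) * (ν i : ℝ)) / q)

/-- Residues `1 ≤ aᵢ ≤ q` (coded by `Fin q`, shifted by one) with `gcd(a₁, …, a_R, s) = 1`. -/
def resSet (R q s : ℕ) : Finset (Fin R → Fin q) :=
  Finset.univ.filter fun a => Nat.gcd (Finset.univ.gcd fun i => (a i : ℕ) + 1) s = 1

/-- The singular series `𝔖(ν)`. -/
def singularSeries {n R : ℕ} (f : Fin R → MvPolynomial (Fin n) ℤ) (ν : Fin R → ℤ) : ℂ :=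
  ∑' q : ℕ, ((q : ℂ) ^ n)⁻¹ *
    ∑ a ∈ resSet R q q, SgaussNu f q (fun i => ((a i : ℕ) : ℤ) + 1) ν

/-- The local density `𝔖_p(ν)`. -/
def localDensity {n R : ℕ} (f : Fin R → MvPolynomial (Fin n) ℤ) (ν : Fin R → ℤ) (p : ℕ) : ℂ :=
  ∑' r : ℕ, ((p : ℂ) ^ (r * n))⁻¹ *
    ∑ a ∈ resSet R (p ^ r) p, SgaussNu f (p ^ r) (fun i => ((a i : ℕ) : ℤ) + 1) ν

/-- The box `𝓑 = ∏ⱼ [aⱼ, bⱼ]` as a subset of `ℝ^n`. -/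
def boxSet {n : ℕ} (aB bB : Fin n → ℝ) : Set (Fin n → ℝ) :=
  Set.univ.pi fun j => Set.Icc (aB j) (bB j)

/-- The oscillatory integral `I(𝓒, γ) = ∫_{ζ ∈ 𝓒} e(γ · g(ζ)) dζ`. -/
def Iosc {n R : ℕ} (g : Fin R → MvPolynomial (Fin n) ℤ) (C : Set (Fin n → ℝ))
    (γ : Fin R → ℝ) : ℂ :=
  ∫ ζ in C, eC (∑ i, γ i * MvPolynomial.aeval ζ (g i))

/-- `J(μ, Φ) = ∫_{|γ| ≤ Φ} I(𝓑, γ) e(-γ·μ) dγ`. -/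
def Jint {n R : ℕ} (g : Fin R → MvPolynomial (Fin n) ℤ) (aB bB : Fin n → ℝ)
    (μ : Fin R → ℝ) (Φ : ℝ) : ℂ :=
  ∫ γ in {γ : Fin R → ℝ | ∀ i, |γ i| ≤ Φ}, Iosc g (boxSet aB bB) γ * eC (-(∑ i, γ i * μ i))

/-- The singular integral `J(μ) = lim_{Φ → ∞} J(μ, Φ)`. -/
def Jlim {n R : ℕ} (g : Fin R → MvPolynomial (Fin n) ℤ) (aB bB : Fin n → ℝ)
    (μ : Fin R → ℝ) : ℂ :=
  limUnder Filter.atTop fun Φ : ℝ => Jint g aB bB μ Φ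

/-- `M(P, ν)`: the number of integer points `x ∈ P𝓑` with `f(x) = ν`. -/
def Mcount {n R : ℕ} (f : Fin R → MvPolynomial (Fin n) ℤ) (aB bB : Fin n → ℝ) (P : ℝ)
    (ν : Fin R → ℤ) : ℕ :=
  ((boxPts aB bB P).filter fun x => ∀ i, MvPolynomial.eval x (f i) = ν i).card

/-- A single major arc `𝔐_{a,q}(θ)`. -/
def majorArc {R : ℕ} (d : ℕ) (Ct P θ : ℝ) (q : ℕ) (a : Fin R → ℤ) : Set (Fin R → ℝ) :=
  Set.univ.pi fun i => Set.Icc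
    ((a i : ℝ) / q - Ct ^ (R - 1) * P ^ (-(d : ℝ) + (R : ℝ) * ((d : ℝ) - 1) * θ) / (2 * q))
    ((a i : ℝ) / q + Ct ^ (R - 1) * P ^ (-(d : ℝ) + (R : ℝ) * ((d : ℝ) - 1) * θ) / (2 * q))

/-- The major arcs `𝔐(θ)`. -/
def majorArcs (R d : ℕ) (Ct P θ : ℝ) : Set (Fin R → ℝ) :=
  ⋃ (q : ℕ) (_ : 1 ≤ q ∧ (q : ℝ) ≤ Ct ^ R * P ^ ((R : ℝ) * ((d : ℝ) - 1) * θ))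
    (a : Fin R → ℤ)
    (_ : (∀ i, 1 ≤ a i ∧ a i ≤ (q : ℤ)) ∧ Int.gcd (Finset.univ.gcd a) (q : ℤ) = 1),
    majorArc d Ct P θ q a

/-- The minor arcs `𝔪 = [0,1]^R \ 𝔐(θ)`, taken modulo `1`. -/
def minorArcs (R d : ℕ) (Ct P θ : ℝ) : Set (Fin R → ℝ) :=
  {α | (∀ i, 0 ≤ α i ∧ α i ≤ 1) ∧
    ∀ z : Fin R → ℤ, (fun i => α i + (z i : ℝ)) ∉ majorArcs R d Ct P θ}

/-- Nonsingularity of the affine variety `f = 0` over `ℚ̄`: at every common zero the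
Jacobian matrix has (maximal) rank `R`, i.e. some `R × R` minor is nonvanishing. -/
def AffineNonsingular {n : ℕ} (R : ℕ) (f : Fin R → MvPolynomial (Fin n) ℤ) : Prop :=
  ∀ x : Fin n → Qbar, (∀ i, MvPolynomial.aeval x (f i) = 0) →
    ∃ (I : Finset (Fin n)) (hI : I.card = R), MvPolynomial.aeval x (jacMinor f I hI) ≠ 0

/-- Nonsingularity of the projective variety `g = 0` over `ℚ̄` (for forms `g`): at every
nonzero point of the affine cone the Jacobian matrix has rank `R`. -/
def ProjNonsingular {n : ℕ} (R : ℕ) (g : Fin R → MvPolynomial (Fin n) ℤ) : Prop :=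
  ∀ x : Fin n → Qbar, x ≠ 0 → (∀ i, MvPolynomial.aeval x (g i) = 0) →
    ∃ (I : Finset (Fin n)) (hI : I.card = R), MvPolynomial.aeval x (jacMinor g I hI) ≠ 0


section AlgebraOne
set_option linter.unusedSectionVars false

attribute [local instance] MvPolynomial.gradedAlgebra

variable {k : Type} [Field k] [CharZero k] {n : ℕ}

/-- integer linear form -/
def linF (k : Type) [Field k] {n : ℕ} (a : Fin n → ℤ) : MvPolynomial (Fin n) k :=
  ∑ j, C ((a j : ℤ) : k) * X j

def chainLE (I : Ideal (MvPolynomial (Fin n) k)) (s : ℕ) : Prop :=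
  ∀ l : LTSeries (PrimeSpectrum.zeroLocus (I : Set (MvPolynomial (Fin n) k))), l.length ≤ s

lemma chainLE_of_ringKrullDim (I : Ideal (MvPolynomial (Fin n) k)) (s : ℕ)
    (h : ringKrullDim (MvPolynomial (Fin n) k ⧸ I) ≤ ((s : ℕ∞) : WithBot ℕ∞)) : chainLE I s := by
  intro l
  rw [ringKrullDim_quotient] at h
  have h2 : ((l.length : ℕ) : WithBot ℕ∞) ≤ _ := (le_iSup (fun p : LTSeries _ => ((p.length : ℕ) : WithBot ℕ∞)) l).trans h
  exact_mod_cast h2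

/-- the irrelevant ideal -/
def mmI (k : Type) [Field k] (n : ℕ) : Ideal (MvPolynomial (Fin n) k) :=
  RingHom.ker (constantCoeff (R := k) (σ := Fin n))

instance : (mmI k n).IsPrime := RingHom.ker_isPrime _

lemma mmI_le (p : Ideal (MvPolynomial (Fin n) k)) (h : ∀ i, X i ∈ p) : mmI k n ≤ p := by
  intro f hf
  have h1 : f ∈ Ideal.span (X '' (Set.univ : Set (Fin n)) : Set (MvPolynomial (Fin n) k)) := by
    rw [mem_ideal_span_X_image]
    intro m hm
    by_contra hcon
    push Not at hcon
    have : m = 0 := by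
      ext i; simpa using hcon i (Set.mem_univ _)
    rw [this] at hm
    rw [mem_support_iff] at hm
    exact hm hf
  refine (Ideal.span_le.2 ?_) h1
  rintro _ ⟨i, -, rfl⟩
  exact h i

lemma minimal_le_mmI (I : Ideal (MvPolynomial (Fin n) k))
    (hI : I.IsHomogeneous (homogeneousSubmodule (Fin n) k))
    (p : Ideal (MvPolynomial (Fin n) k)) (hp : p ∈ I.minimalPrimes) : p ≤ mmI k n := by
  have hpp : p.IsPrime := hp.1.1
  have h1 := hpp.homogeneousCore (𝒜 := homogeneousSubmodule (Fin n) k)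
  have h2 : (p.homogeneousCore (homogeneousSubmodule (Fin n) k)).toIdeal ≤ p :=
    Ideal.toIdeal_homogeneousCore_le _ _
  have h3 : I ≤ (p.homogeneousCore (homogeneousSubmodule (Fin n) k)).toIdeal := by
    rw [← hI.toIdeal_homogeneousCore_eq_self]
    exact Ideal.homogeneousCore_mono _ hp.1.2
  have h4 : p ≤ (p.homogeneousCore (homogeneousSubmodule (Fin n) k)).toIdeal := hp.2 ⟨h1, h3⟩ h2
  have hph : p.IsHomogeneous (homogeneousSubmodule (Fin n) k) := by
    have := le_antisymm h2 h4
    rw [← this]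
    exact HomogeneousIdeal.isHomogeneous _
  intro f hf
  have h5 := homogeneousComponent_mem_of_mem hph hf 0
  rw [homogeneousComponent_zero] at h5
  by_contra hcon
  have hc : coeff 0 f ≠ 0 := hcon
  exact hpp.ne_top (Ideal.eq_top_of_isUnit_mem _ h5 ((isUnit_iff_ne_zero.2 hc).map C))

lemma exists_avoid (S : Set (Ideal (MvPolynomial (Fin n) k))) (hS : S.Finite)
    (h : ∀ p ∈ S, ∃ i, X i ∉ p) : ∃ a : Fin n → ℤ, ∀ p ∈ S, linF k a ∉ p := by
  classical
  let V : Ideal (MvPolynomial (Fin n) k) → Subspace ℚ (Fin n → ℚ) := fun p =>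
    { carrier := {a | ∑ j, C ((a j : ℚ) : k) * X j ∈ p}
      add_mem' := by
        intro a b ha hb
        have := p.add_mem ha hb
        simpa [add_mul, Finset.sum_add_distrib] using this
      zero_mem' := by simp
      smul_mem' := by
        intro c a ha
        have := p.mul_mem_left (C (c : k)) ha
        simpa [Finset.mul_sum, mul_assoc] using this }
  have hV : ⊤ ∉ hS.toFinset.image V := by
    intro hcon
    simp only [Finset.mem_image, Set.Finite.mem_toFinset] at hcon
    obtain ⟨p, hp, hpt⟩ := hcon
    obtain ⟨i, hi⟩ := h p hp
    have h1 : (Pi.single i 1 : Fin n → ℚ) ∈ V p := by rw [hpt]; trivial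
    apply hi
    have h2 : ∑ j, C (((Pi.single i 1 : Fin n → ℚ) j : ℚ) : k) * X j ∈ p := h1
    rw [Finset.sum_eq_single i] at h2
    · simpa using h2
    · intro b _ hb; simp [hb]
    · simp
  have h1 := Subspace.biUnion_ne_univ_of_top_notMem hV
  rw [Set.ne_univ_iff_exists_notMem] at h1
  obtain ⟨a, ha⟩ := h1
  obtain ⟨b, hb⟩ := IsLocalization.exist_integer_multiples_of_finite (nonZeroDivisors ℤ) a
  choose z hz using hb
  refine ⟨z, fun p hp hcon => ha ?_⟩
  simp only [Finset.mem_image, Set.Finite.mem_toFinset, Set.iUnion_exists, Set.mem_iUnion]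
  refine ⟨V p, p, ⟨hp, rfl⟩, ?_⟩
  change ∑ j, C ((a j : ℚ) : k) * X j ∈ p
  have hb0 : ((b : ℤ) : k) ≠ 0 := by
    have := nonZeroDivisors.coe_ne_zero b
    exact_mod_cast this
  have h2 := p.mul_mem_left (C (((b : ℤ) : k)⁻¹)) hcon
  convert h2 using 1
  unfold linF
  rw [Finset.mul_sum]
  refine Finset.sum_congr rfl fun j _ => ?_
  rw [← mul_assoc, ← C_mul]
  congr 2
  have h3 : ((z j : ℤ) : ℚ) = (b : ℤ) * a j := by
    have := hz j
    simpa using this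
  have h4 : ((z j : ℤ) : k) = (b : ℤ) * ((a j : ℚ) : k) := by
    have := congrArg (fun q : ℚ => (q : k)) h3
    simpa using this
  rw [h4, inv_mul_cancel_left₀ hb0]

lemma linF_isHomogeneous (a : Fin n → ℤ) : (linF k a).IsHomogeneous 1 :=
  IsHomogeneous.sum _ _ _ fun _ _ => isHomogeneous_C_mul_X _ _

lemma exists_linear_forms (s : ℕ) : ∀ (I : Ideal (MvPolynomial (Fin n) k)),
    I.IsHomogeneous (homogeneousSubmodule (Fin n) k) → chainLE I s →
    ∃ m : Fin s → Fin n → ℤ,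
      ∀ i, X i ∈ (I ⊔ Ideal.span (Set.range fun j => linF k (m j))).radical := by
  induction s with
  | zero =>
    intro I hI hc
    refine ⟨fun _ _ => 0, fun i => ?_⟩
    refine Ideal.radical_mono le_sup_left ?_
    rw [Ideal.radical_eq_sInf]
    rw [Submodule.mem_sInf]
    rintro q ⟨hq, hqp⟩
    obtain ⟨p, hp, hpq⟩ := Ideal.exists_minimalPrimes_le hq
    have hpm := minimal_le_mmI I hI p hp
    apply hpq
    by_contra hcon
    have hlt : p < mmI k n := lt_of_le_of_ne hpm (fun h => hcon (by
      rw [h]; change constantCoeff (X i) = 0; simp))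
    have hp1 : p.IsPrime := hp.1.1
    let P : PrimeSpectrum.zeroLocus (I : Set (MvPolynomial (Fin n) k)) := ⟨⟨p, hp1⟩, hp.1.2⟩
    let M : PrimeSpectrum.zeroLocus (I : Set (MvPolynomial (Fin n) k)) :=
      ⟨⟨mmI k n, inferInstance⟩, hp.1.2.trans hpm⟩
    have hPM : P < M := hlt
    have := hc ((RelSeries.singleton _ M).cons P hPM)
    exact absurd this (by
      rw [not_le]
      exact Nat.succ_pos _)
  | succ s ih =>
    intro I hI hc
    by_cases hm : mmI k n ∈ I.minimalPrimes
    · refine ⟨fun _ _ => 0, fun i => ?_⟩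
      refine Ideal.radical_mono le_sup_left ?_
      rw [Ideal.radical_eq_sInf]
      rw [Submodule.mem_sInf]
      rintro q ⟨hq, hqp⟩
      obtain ⟨p, hp, hpq⟩ := Ideal.exists_minimalPrimes_le hq
      have hpm := minimal_le_mmI I hI p hp
      apply hpq
      apply hm.2 hp.1 hpm
      change constantCoeff (X i) = 0; simp
    · obtain ⟨a, ha⟩ := exists_avoid (k := k) (n := n) I.minimalPrimes
        (Ideal.finite_minimalPrimes_of_isNoetherianRing _ I) (by
          intro p hp
          by_contra hcon
          push Not at hcon
          have := le_antisymm (minimal_le_mmI I hI p hp) (mmI_le p hcon)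
          exact hm (this ▸ hp))
      have hJ : (I ⊔ Ideal.span {linF k a}).IsHomogeneous (homogeneousSubmodule (Fin n) k) := by
        refine Ideal.IsHomogeneous.sup hI (Ideal.homogeneous_span _ _ ?_)
        rintro x rfl
        exact ⟨1, linF_isHomogeneous a⟩
      obtain ⟨m, hm2⟩ := ih (I ⊔ Ideal.span {linF k a}) hJ (by
        intro l
        have hle : I ⊔ Ideal.span {linF k a} ≤ l.head.1.asIdeal := l.head.2
        obtain ⟨p, hp, hp'⟩ := Ideal.exists_minimalPrimes_le (J := l.head.1.asIdeal)
          (le_sup_left.trans hle)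
        let f : PrimeSpectrum.zeroLocus ((I ⊔ Ideal.span {linF k a} : Ideal _) :
            Set (MvPolynomial (Fin n) k)) →
          PrimeSpectrum.zeroLocus (I : Set (MvPolynomial (Fin n) k)) := fun q =>
            ⟨q.1, (le_sup_left (a := I)).trans q.2⟩
        have hf : StrictMono f := fun _ _ h => h
        have hp1 : p.IsPrime := hp.1.1
        let P : PrimeSpectrum.zeroLocus (I : Set (MvPolynomial (Fin n) k)) := ⟨⟨p, hp1⟩, hp.1.2⟩
        have hP : P < (l.map f hf).head := by
          refine lt_of_le_of_ne hp' ?_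
          intro h
          apply ha p hp
          have h1 : p = l.head.1.asIdeal := congrArg (fun q => q.1.asIdeal) h
          rw [h1]
          exact hle (Ideal.mem_sup_right (Ideal.subset_span rfl))
        have := hc ((l.map f hf).cons P hP)
        simpa using this)
      refine ⟨Fin.cons a m, fun i => ?_⟩
      refine Ideal.radical_mono ?_ (hm2 i)
      refine sup_le (sup_le le_sup_left ?_) ?_
      · rw [Ideal.span_le]
        rintro x rfl
        exact Ideal.mem_sup_right (Ideal.subset_span ⟨0, by simp⟩)
      · rw [Ideal.span_le]
        rintro _ ⟨j, rfl⟩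
        exact Ideal.mem_sup_right (Ideal.subset_span ⟨j.succ, by simp⟩)

end AlgebraOne

section AlgebraTwo
set_option linter.unusedSectionVars false
attribute [local instance] MvPolynomial.gradedAlgebra

variable {k : Type} [Field k] [CharZero k] {n : ℕ}

def GoodF (d : ℕ) (g : MvPolynomial (Fin n) k) (s : ℕ) (q : ℕ × (Fin s → Fin n → ℤ)) : Prop :=
  d ≤ q.1 ∧ ∀ α : Fin n →₀ ℕ, α.degree = q.1 → (monomial α (1 : k)) ∈
    Ideal.span (Set.range fun j : Fin n => pderiv j g) ⊔
      Ideal.span (Set.range fun j : Fin s => linF k (q.2 j))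

lemma exists_goodF (d s : ℕ) (g : MvPolynomial (Fin n) k) (hg : g.IsHomogeneous d)
    (h : ringKrullDim (MvPolynomial (Fin n) k ⧸
      Ideal.span (Set.range fun j : Fin n => pderiv j g)) ≤ ((s : ℕ∞) : WithBot ℕ∞)) :
    ∃ q, GoodF d g s q := by
  set I := Ideal.span (Set.range fun j : Fin n => pderiv j g) with hI
  have hhom : I.IsHomogeneous (homogeneousSubmodule (Fin n) k) := by
    refine Ideal.homogeneous_span _ _ ?_
    rintro _ ⟨j, rfl⟩
    exact ⟨d - 1, hg.pderiv⟩
  obtain ⟨m, hm⟩ := exists_linear_forms s I hhom (chainLE_of_ringKrullDim I s h)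
  set J := I ⊔ Ideal.span (Set.range fun j : Fin s => linF k (m j)) with hJ
  obtain ⟨D, hD⟩ := J.exists_radical_pow_le_of_fg (IsNoetherian.noetherian _)
  refine ⟨(D + d, m), by simp, fun α hα => ?_⟩
  apply hD
  apply Ideal.pow_le_pow_right (Nat.le_add_right D d)
  have h1 : monomial α (1 : k) = ∏ i, X i ^ (α i) := by
    rw [monomial_eq, C_1, one_mul, Finsupp.prod_fintype _ _ (by simp)]
  have h2 : D + d = ∑ i, α i := by
    rw [← Finsupp.degree_eq_sum]; exact hα.symm
  rw [h1, h2, ← Finset.prod_pow_eq_pow_sum]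
  exact Ideal.prod_mem_prod fun i _ => Ideal.pow_mem_pow (hm i) _

lemma homComp_mul {P : Type} [CommRing P] {e D : ℕ} (heD : e ≤ D) (a q : MvPolynomial (Fin n) P)
    (hq : q.IsHomogeneous e) :
    homogeneousComponent D (a * q) = homogeneousComponent (D - e) a * q := by
  have h1 : ∀ i, homogeneousComponent D (homogeneousComponent i a * q) =
      if i = D - e then homogeneousComponent i a * q else 0 := by
    intro i
    have h2 : (homogeneousComponent i a * q) ∈ homogeneousSubmodule (Fin n) P (i + e) :=
      (homogeneousComponent_isHomogeneous i a).mul hq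
    rw [homogeneousComponent_of_mem h2]
    congr 1
    apply propext
    omega
  conv_lhs => rw [← sum_homogeneousComponent a, Finset.sum_mul, map_sum]
  simp_rw [h1]
  rw [Finset.sum_ite_eq']
  split_ifs with h
  · rfl
  · rw [homogeneousComponent_eq_zero, zero_mul]
    simp at h; omega

lemma GoodF.decomp {d s : ℕ} (hd : 1 ≤ d) {g : MvPolynomial (Fin n) k} (hg : g.IsHomogeneous d)
    {q : ℕ × (Fin s → Fin n → ℤ)} (h : GoodF d g s q) (α : Fin n →₀ ℕ) (hα : α.degree = q.1) :
    ∃ (a : Fin n → MvPolynomial (Fin n) k) (b : Fin s → MvPolynomial (Fin n) k),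
      (∀ i, (a i).IsHomogeneous (q.1 - (d - 1))) ∧ (∀ j, (b j).IsHomogeneous (q.1 - 1)) ∧
      monomial α (1 : k) = ∑ i, a i * pderiv i g + ∑ j, b j * linF k (q.2 j) := by
  obtain ⟨hdD, h⟩ := h
  have h1 := h α hα
  rw [Submodule.mem_sup] at h1
  obtain ⟨x, hx, y, hy, hxy⟩ := h1
  rw [Ideal.mem_span_range_iff_exists_fun] at hx hy
  obtain ⟨a, rfl⟩ := hx
  obtain ⟨b, rfl⟩ := hy
  refine ⟨fun i => homogeneousComponent (q.1 - (d - 1)) (a i),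
    fun j => homogeneousComponent (q.1 - 1) (b j),
    fun i => homogeneousComponent_isHomogeneous _ _,
    fun i => homogeneousComponent_isHomogeneous _ _, ?_⟩
  have h2 := congrArg (homogeneousComponent q.1) hxy
  rw [homogeneousComponent_eq_self (isHomogeneous_monomial (1 : k) hα)] at h2
  rw [← h2, map_add, map_sum, map_sum]
  congr 1
  · refine Finset.sum_congr rfl fun i _ => ?_
    rw [homComp_mul (by omega) _ _ hg.pderiv]
  · refine Finset.sum_congr rfl fun i _ => ?_
    rw [homComp_mul (by omega) _ _ (linF_isHomogeneous _)]

abbrev MonT (n D : ℕ) : Type := {α : Fin n →₀ ℕ // α ∈ Finset.finsuppAntidiag Finset.univ D}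

lemma MonT.degree {n D : ℕ} (α : MonT n D) : α.1.degree = D := by
  have := α.2
  rw [Finset.mem_finsuppAntidiag] at this
  rw [Finsupp.degree_eq_sum]; exact this.1

def MonT.mk' {n D : ℕ} (α : Fin n →₀ ℕ) (h : α.degree = D) : MonT n D :=
  ⟨α, by rw [Finset.mem_finsuppAntidiag, ← Finsupp.degree_eq_sum]; simp [h]⟩

/-- A homogeneous polynomial is the sum of its monomials. -/
lemma hom_eq_sum {P : Type} [CommRing P] {D : ℕ} (q : MvPolynomial (Fin n) P)
    (hq : q.IsHomogeneous D) : q = ∑ β : MonT n D, monomial β.1 (coeff β.1 q) := by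
  classical
  ext γ
  rw [coeff_sum]
  by_cases hγ : γ.degree = D
  · rw [Finset.sum_eq_single (MonT.mk' γ hγ)]
    · simp [MonT.mk']
    · intro b _ hb
      rw [coeff_monomial, if_neg]
      intro h
      exact hb (Subtype.ext h)
    · simp
  · rw [hq.coeff_eq_zero hγ, Finset.sum_eq_zero]
    intro b _
    rw [coeff_monomial, if_neg]
    intro h
    exact hγ (h ▸ b.degree)

/-- universal form -/
def gU (k : Type) [Field k] (n d : ℕ) : MvPolynomial (Fin n) (MvPolynomial (MonT n d) k) :=
  ∑ t : MonT n d, monomial t.1 (X t)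

def evG {d : ℕ} (g : MvPolynomial (Fin n) k) : MvPolynomial (MonT n d) k →+* k :=
  eval fun t => coeff t.1 g

lemma map_gU {d : ℕ} (g : MvPolynomial (Fin n) k) (hg : g.IsHomogeneous d) :
    MvPolynomial.map (evG (d := d) g) (gU k n d) = g := by
  conv_rhs => rw [hom_eq_sum g hg]
  simp [gU, evG]

lemma gU_hom (d : ℕ) : (gU k n d).IsHomogeneous d :=
  IsHomogeneous.sum _ _ _ fun t _ => isHomogeneous_monomial _ t.degree

def JU (k : Type) [Field k] (n d s : ℕ) (m : Fin s → Fin n → ℤ) :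
    Ideal (MvPolynomial (Fin n) (MvPolynomial (MonT n d) k)) :=
  Ideal.span (Set.range fun j : Fin n => pderiv j (gU k n d)) ⊔
      Ideal.span (Set.range fun j : Fin s => MvPolynomial.map C (linF k (m j)))

def PU (k : Type) [Field k] (n d s : ℕ) (q : ℕ × (Fin s → Fin n → ℤ)) :
    Set (MvPolynomial (MonT n d) k) :=
  {a | d ≤ q.1 ∧ ∀ α : Fin n →₀ ℕ, α.degree = q.1 → C a * monomial α 1 ∈ JU k n d s q.2}

lemma map_evG_C {d : ℕ} (g p : MvPolynomial (Fin n) k) :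
    MvPolynomial.map (evG (d := d) g) (MvPolynomial.map C p) = p := by
  rw [MvPolynomial.map_map]
  have : (evG (d := d) g).comp C = RingHom.id k := by
    ext x; simp [evG]
  rw [this, MvPolynomial.map_id]

lemma goodF_of_mem_PU {d s : ℕ} {g : MvPolynomial (Fin n) k} (hg : g.IsHomogeneous d)
    {q : ℕ × (Fin s → Fin n → ℤ)} {a : MvPolynomial (MonT n d) k} (ha : a ∈ PU k n d s q)
    (ha0 : evG g a ≠ 0) : GoodF d g s q := by
  refine ⟨ha.1, fun α hα => ?_⟩
  have h1 := Ideal.mem_map_of_mem (MvPolynomial.map (evG (d := d) g)) (ha.2 α hα)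
  rw [JU, Ideal.map_sup, Ideal.map_span, Ideal.map_span, ← Set.range_comp, ← Set.range_comp] at h1
  have e1 : (⇑(MvPolynomial.map (evG (d := d) g)) ∘ fun j => pderiv j (gU k n d)) = fun j => pderiv j g := by
    funext j
    simp only [Function.comp]
    rw [← pderiv_map, map_gU g hg]
  have e2 : (⇑(MvPolynomial.map (evG (d := d) g)) ∘ fun j => MvPolynomial.map C (linF k (q.2 j))) =
      fun j => linF k (q.2 j) := by
    funext j
    simp only [Function.comp]
    rw [map_evG_C]
  rw [e1, e2] at h1
  have h2 := Ideal.mul_mem_left _ (C (evG g a)⁻¹) h1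
  have h3 : C (evG g a)⁻¹ * MvPolynomial.map (evG g) (C a * monomial α 1) = monomial α 1 := by
    rw [map_mul, map_C, map_monomial, map_one, ← mul_assoc, ← C_mul, inv_mul_cancel₀ ha0,
      C_1, one_mul]
  rwa [h3] at h2

lemma exists_mem_PU {d s : ℕ} (hd : 1 ≤ d) {g : MvPolynomial (Fin n) k} (hg : g.IsHomogeneous d)
    {q : ℕ × (Fin s → Fin n → ℤ)} (h : GoodF d g s q) :
    ∃ a ∈ PU k n d s q, evG g a ≠ 0 := by
  classical
  have hdec := fun α : MonT n q.1 => h.decomp hd hg α.1 α.degree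
  choose a b ha hb hab using hdec
  let N : MonT n q.1 → MvPolynomial (Fin n) (MvPolynomial (MonT n d) k) := fun α =>
    ∑ i, MvPolynomial.map C (a α i) * pderiv i (gU k n d) + ∑ j, MvPolynomial.map C (b α j) * MvPolynomial.map C (linF k (q.2 j))
  have hNJ : ∀ α, N α ∈ JU k n d s q.2 := by
    intro α
    refine Ideal.add_mem _ (Ideal.mem_sup_left ?_) (Ideal.mem_sup_right ?_)
    · exact Ideal.sum_mem _ fun i _ => Ideal.mul_mem_left _ _ (Ideal.subset_span ⟨i, rfl⟩)
    · exact Ideal.sum_mem _ fun i _ => Ideal.mul_mem_left _ _ (Ideal.subset_span ⟨i, rfl⟩)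
  have hdq : d ≤ q.1 := h.1
  have hNh : ∀ α, (N α).IsHomogeneous q.1 := by
    intro α
    refine IsHomogeneous.add (IsHomogeneous.sum _ _ _ fun i _ => ?_)
      (IsHomogeneous.sum _ _ _ fun i _ => ?_)
    · have := ((ha α i).map (C : k →+* MvPolynomial (MonT n d) k)).mul
        ((gU_hom (k := k) (n := n) d).pderiv (i := i))
      convert this using 1; omega
    · have := ((hb α i).map (C : k →+* MvPolynomial (MonT n d) k)).mul
        ((linF_isHomogeneous (k := k) (q.2 i)).map (C : k →+* MvPolynomial (MonT n d) k))
      convert this using 1; omega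
  have hNm : ∀ α, MvPolynomial.map (evG g) (N α) = monomial α.1 1 := by
    intro α
    rw [hab α]
    have e1 : ∀ i, MvPolynomial.map (evG g) (MvPolynomial.map C (a α i) * pderiv i (gU k n d)) =
        a α i * pderiv i g := by
      intro i
      rw [RingHom.map_mul, map_evG_C, ← pderiv_map, map_gU g hg]
    have e2 : ∀ j, MvPolynomial.map (evG (d := d) g)
        (MvPolynomial.map C (b α j) * MvPolynomial.map C (linF k (q.2 j))) =
        b α j * linF k (q.2 j) := by
      intro j
      rw [RingHom.map_mul, map_evG_C, map_evG_C]
    change MvPolynomial.map (evG g) (_ + _) = _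
    rw [RingHom.map_add, map_sum, map_sum]
    exact congrArg₂ _ (Finset.sum_congr rfl fun i _ => e1 i) (Finset.sum_congr rfl fun i _ => e2 i)
  let M : Matrix (MonT n q.1) (MonT n q.1) (MvPolynomial (MonT n d) k) :=
    Matrix.of fun α β => coeff β.1 (N α)
  refine ⟨M.det, ⟨h.1, fun α hα => ?_⟩, ?_⟩
  · have h1 : C M.det * monomial α 1 = ∑ α', C (M.adjugate (MonT.mk' α hα) α') * N α' := by
      have h2 : ∀ α', C (M.adjugate (MonT.mk' α hα) α') * N α' =
          ∑ β : MonT n q.1, monomial β.1 (M.adjugate (MonT.mk' α hα) α' * M α' β) := by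
        intro α'
        conv_lhs => rw [hom_eq_sum (N α') (hNh α')]
        rw [Finset.mul_sum]
        refine Finset.sum_congr rfl fun β _ => ?_
        rw [C_mul_monomial]; rfl
      simp_rw [h2]
      rw [Finset.sum_comm]
      simp_rw [← map_sum, ← Matrix.mul_apply, Matrix.adjugate_mul]
      rw [Finset.sum_eq_single (MonT.mk' α hα)]
      · simp [C_mul_monomial, MonT.mk']
      · intro β _ hβ
        rw [Matrix.smul_apply, Matrix.one_apply_ne hβ.symm, smul_zero, map_zero]
      · simp
    rw [h1]
    exact Ideal.sum_mem _ fun i _ => Ideal.mul_mem_left _ _ (hNJ i)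
  · have h1 : evG g M.det = 1 := by
      rw [RingHom.map_det]
      have : (evG g).mapMatrix M = 1 := by
        ext α β
        have h2 := congrArg (coeff β.1) (hNm α)
        rw [coeff_map] at h2
        simp only [RingHom.mapMatrix_apply, Matrix.map_apply, M, Matrix.of_apply]
        rw [h2, coeff_monomial, Matrix.one_apply]
        by_cases hαβ : α = β
        · rw [if_pos hαβ, if_pos (congrArg Subtype.val hαβ)]
        · rw [if_neg hαβ, if_neg (fun hh => hαβ (Subtype.ext hh))]
      rw [this, Matrix.det_one]
    rw [h1]; exact one_ne_zero

lemma uniform_goodF (k : Type) [Field k] [CharZero k] (n d s : ℕ) (hd : 1 ≤ d) :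
    ∃ F : Finset (ℕ × (Fin s → Fin n → ℤ)), ∀ g : MvPolynomial (Fin n) k, g.IsHomogeneous d →
      (∃ q, GoodF d g s q) → ∃ q ∈ F, GoodF d g s q := by
  classical
  have h1 := (Submodule.fg_span_iff_fg_span_finset_subset (⋃ q, PU k n d s q)).1
    (IsNoetherian.noetherian (Submodule.span (MvPolynomial (MonT n d) k) (⋃ q, PU k n d s q)))
  obtain ⟨S, hS, hSe⟩ := h1
  have h2 : ∀ a : S, ∃ q, a.1 ∈ PU k n d s q := fun a => by
    simpa using hS a.2
  choose idx hidx using h2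
  refine ⟨Finset.univ.image idx, fun g hg ⟨q, hq⟩ => ?_⟩
  obtain ⟨a, ha, ha0⟩ := exists_mem_PU hd hg hq
  have h3 : a ∈ Submodule.span (MvPolynomial (MonT n d) k) (S : Set (MvPolynomial (MonT n d) k)) := by
    rw [← hSe]
    exact Submodule.subset_span (Set.mem_iUnion.2 ⟨q, ha⟩)
  have h4 : ∃ a' ∈ S, evG g a' ≠ 0 := by
    by_contra hcon
    push Not at hcon
    apply ha0
    have : Ideal.span (S : Set (MvPolynomial (MonT n d) k)) ≤ RingHom.ker (evG (d := d) g) :=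
      Ideal.span_le.2 fun x hx => hcon x hx
    exact this h3
  obtain ⟨a', ha', ha'0⟩ := h4
  exact ⟨idx ⟨a', ha'⟩, by simp, goodF_of_mem_PU hg (hidx ⟨a', ha'⟩) ha'0⟩

end AlgebraTwo

section AlgebraThree

variable {k : Type} [Field k] [CharZero k] {n : ℕ}

lemma eval_separate (F : Finset (Fin n → k)) (x : Fin n → k) :
    ∃ p : MvPolynomial (Fin n) k, eval x p ≠ 0 ∧ ∀ y ∈ F, y ≠ x → eval y p = 0 := by
  classical
  have h : ∀ y : Fin n → k, ∃ p : MvPolynomial (Fin n) k, y ≠ x → eval x p ≠ 0 ∧ eval y p = 0 := by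
    intro y
    by_cases hy : y = x
    · exact ⟨0, fun h => absurd hy h⟩
    · obtain ⟨j, hj⟩ := Function.ne_iff.1 hy
      refine ⟨X j - C (y j), fun _ => ⟨?_, ?_⟩⟩
      · simp [sub_eq_zero]; exact fun h => hj h.symm
      · simp
  choose p hp using h
  refine ⟨∏ y ∈ F.erase x, p y, ?_, ?_⟩
  · rw [map_prod, Finset.prod_ne_zero_iff]
    intro y hy
    exact (hp y (Finset.mem_erase.1 hy).1).1
  · intro y hy hyx
    rw [map_prod]
    exact Finset.prod_eq_zero (Finset.mem_erase.2 ⟨hyx, hy⟩) (hp y hyx).2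

lemma mon_step (D : ℕ) (F : Finset (Fin n → k))
    (h : ∀ α : Fin n →₀ ℕ, α.degree = D → ∃ p : MvPolynomial (Fin n) k,
      p ∈ restrictTotalDegree (Fin n) k (D - 1) ∧ ∀ x ∈ F, eval x (monomial α 1) = eval x p)
    (hD : 0 < D) (N : ℕ) (hN : D ≤ N) : ∀ α : Fin n →₀ ℕ, α.degree = N →
      ∃ p : MvPolynomial (Fin n) k,
      p ∈ restrictTotalDegree (Fin n) k (N - 1) ∧ ∀ x ∈ F, eval x (monomial α 1) = eval x p := by
  induction N, hN using Nat.le_induction with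
  | base => exact h
  | succ N hN ih =>
    intro α hα
    have : α ≠ 0 := by rintro rfl; simp at hα
    obtain ⟨i, hi⟩ := Finsupp.ne_iff.1 this
    have hle : Finsupp.single i 1 ≤ α := by
      rw [Finsupp.single_le_iff]; simp at hi; omega
    obtain ⟨β, rfl⟩ := exists_add_of_le hle
    have hβ : β.degree = N := by
      rw [map_add, Finsupp.degree_single] at hα; omega
    obtain ⟨p, hp, hpe⟩ := ih β hβ
    refine ⟨X i * p, ?_, ?_⟩
    · rw [mem_restrictTotalDegree] at hp ⊢
      refine (totalDegree_mul _ _).trans ?_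
      rw [totalDegree_X]; omega
    · intro x hx
      rw [map_mul, ← hpe x hx, ← map_mul, X, monomial_mul, one_mul]

lemma fiber_count {d s : ℕ} (hd : 2 ≤ d) {g : MvPolynomial (Fin n) k} (hg : g.IsHomogeneous d)
    {q : ℕ × (Fin s → Fin n → ℤ)} (h : GoodF d g s q) (lam : k) (hlam : lam ≠ 0)
    (Ψ : Fin n → MvPolynomial (Fin n) k)
    (hΨ : ∀ i, (Ψ i - C lam * pderiv i g).totalDegree < d - 1)
    (F : Finset (Fin n → k)) (hF : ∀ x ∈ F, ∀ i, eval x (Ψ i) = 0)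
    (c : Fin s → k) (hc : ∀ x ∈ F, ∀ j, eval x (linF k (q.2 j)) = c j) :
    F.card ≤ q.1 ^ n := by
  classical
  have hdq : d ≤ q.1 := h.1
  have h0 : ∀ α : Fin n →₀ ℕ, α.degree = q.1 → ∃ p : MvPolynomial (Fin n) k,
      p ∈ restrictTotalDegree (Fin n) k (q.1 - 1) ∧
        ∀ x ∈ F, eval x (monomial α 1) = eval x p := by
    intro α hα
    obtain ⟨a, b, ha, hb, hab⟩ := h.decomp (by omega) hg α hα
    refine ⟨∑ i, a i * (C (-lam⁻¹) * (Ψ i - C lam * pderiv i g)) + ∑ j, b j * C (c j), ?_, ?_⟩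
    · refine Submodule.add_mem _ (Submodule.sum_mem _ fun i _ => ?_)
        (Submodule.sum_mem _ fun i _ => ?_)
      · rw [mem_restrictTotalDegree]
        refine (totalDegree_mul _ _).trans ?_
        have h1 := (ha i).totalDegree_le
        have h2 := (totalDegree_mul (C (-lam⁻¹)) (Ψ i - C lam * pderiv i g))
        rw [totalDegree_C] at h2
        have h3 := hΨ i
        omega
      · rw [mem_restrictTotalDegree]
        refine (totalDegree_mul _ _).trans ?_
        rw [totalDegree_C]
        exact (hb i).totalDegree_le
    · intro x hx
      rw [hab, map_add, map_add, map_sum, map_sum, map_sum, map_sum]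
      congr 1
      · refine Finset.sum_congr rfl fun i _ => ?_
        simp only [map_mul, map_sub, hF x hx i, eval_C]
        field_simp
        ring
      · refine Finset.sum_congr rfl fun i _ => ?_
        rw [map_mul, map_mul, hc x hx, eval_C]
  have hstep := mon_step q.1 F h0 (by omega)
  let ev : MvPolynomial (Fin n) k →ₗ[k] (F → k) :=
    LinearMap.pi fun x => (aeval (R := k) x.1).toLinearMap
  have hev : ∀ p x, ev p x = eval x.1 p := fun p x => by
    simp [ev, coe_aeval_eq_eval]
  let v : (Fin n → Fin q.1) → (F → k) := fun β =>
    ev (monomial (Finsupp.equivFunOnFinite.symm fun j => (β j : ℕ)) 1)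
  let W := Submodule.span k (Set.range v)
  have hmon : ∀ N : ℕ, ∀ α : Fin n →₀ ℕ, α.degree = N → ev (monomial α 1) ∈ W := by
    intro N
    induction N using Nat.strong_induction_on with
    | _ N ih =>
      intro α hα
      by_cases hN : N < q.1
      · refine Submodule.subset_span ⟨fun j => ⟨α j, ?_⟩, ?_⟩
        · exact (Finsupp.le_degree j α).trans_lt (by omega)
        · simp only [v]
          congr 2
          ext j; simp
      · push Not at hN
        obtain ⟨p, hp, hpe⟩ := hstep N hN α hα
        have h1 : ev (monomial α 1) = ev p := by
          funext x
          rw [hev, hev]; exact hpe _ x.2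
        rw [h1, p.as_sum, map_sum]
        refine Submodule.sum_mem _ fun β hβ => ?_
        have h2 : monomial β (coeff β p) = coeff β p • monomial β 1 := by
          rw [smul_monomial]; simp
        rw [h2, map_smul]
        refine Submodule.smul_mem _ _ (ih β.degree ?_ β rfl)
        rw [mem_restrictTotalDegree] at hp
        have := le_totalDegree hβ
        have h3 : β.degree = β.sum fun _ e => e := rfl
        rw [← h3] at this
        omega
  have hall : ∀ p, ev p ∈ W := by
    intro p
    rw [p.as_sum, map_sum]
    refine Submodule.sum_mem _ fun β hβ => ?_
    have h2 : monomial β (coeff β p) = coeff β p • monomial β 1 := by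
      rw [smul_monomial]; simp
    rw [h2, map_smul]
    exact Submodule.smul_mem _ _ (hmon _ β rfl)
  have htop : W = ⊤ := by
    rw [eq_top_iff]
    intro f _
    have h1 := eval_separate F
    choose p hp hp2 using h1
    have : f = ∑ x : F, (f x / eval x.1 (p x.1)) • ev (p x.1) := by
      funext y
      rw [Finset.sum_apply, Finset.sum_eq_single y]
      · simp only [Pi.smul_apply, hev, smul_eq_mul]
        rw [div_mul_cancel₀ _ (hp y.1)]
      · intro b _ hb
        simp only [Pi.smul_apply, hev, smul_eq_mul]
        rw [hp2 b.1 y.1 y.2 (fun h => hb (Subtype.ext h).symm), mul_zero]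
      · simp
    rw [this]
    exact Submodule.sum_mem _ fun x _ => Submodule.smul_mem _ _ (hall _)
  have h1 := finrank_range_le_card (R := k) v
  rw [Set.finrank] at h1
  have h2 : Module.finrank k (Submodule.span k (Set.range v)) = F.card := by
    change Module.finrank k W = _
    rw [htop, finrank_top, Module.finrank_fintype_fun_eq_card, Fintype.card_coe]
  rw [h2] at h1
  simpa using h1

end AlgebraThree

section AlgebraFour

lemma count_zeros (k : Type) [Field k] [CharZero k] (n d s : ℕ) (hd : 2 ≤ d) :
    ∃ c : ℕ, ∀ g : MvPolynomial (Fin n) k, g.IsHomogeneous d →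
      ringKrullDim (MvPolynomial (Fin n) k ⧸
        Ideal.span (Set.range fun j : Fin n => pderiv j g)) ≤ ((s : ℕ∞) : WithBot ℕ∞) →
      ∀ lam : k, lam ≠ 0 → ∀ Ψ : Fin n → MvPolynomial (Fin n) k,
      (∀ i, (Ψ i - C lam * pderiv i g).totalDegree < d - 1) →
      ∀ H : ℕ, 1 ≤ H → ∀ S : Finset (Fin n → ℤ), (∀ x ∈ S, ∀ j, |x j| ≤ H) →
      (∀ x ∈ S, ∀ i, eval (fun j => ((x j : ℤ) : k)) (Ψ i) = 0) → S.card ≤ c * H ^ s := by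
  classical
  obtain ⟨F, hF⟩ := uniform_goodF k n d s (by omega)
  let A : ℕ := ∑ q ∈ F, ∑ j : Fin s, ∑ i : Fin n, (q.2 j i).natAbs
  let D : ℕ := ∑ q ∈ F, q.1
  refine ⟨D ^ n * (2 * A + 1) ^ s, ?_⟩
  intro g hg hdim lam hlam Ψ hΨ H hH S hS hS0
  obtain ⟨q, hqF, hq⟩ := hF g hg (exists_goodF d s g hg hdim)
  have hD : q.1 ≤ D := Finset.single_le_sum (f := fun q : ℕ × (Fin s → Fin n → ℤ) => q.1)
    (fun _ _ => Nat.zero_le _) hqF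
  have hA : ∀ j, ∑ i, |q.2 j i| ≤ (A : ℤ) := by
    intro j
    have h1 : ∑ j : Fin s, ∑ i : Fin n, (q.2 j i).natAbs ≤ A :=
      Finset.single_le_sum (f := fun q : ℕ × (Fin s → Fin n → ℤ) =>
        ∑ j : Fin s, ∑ i : Fin n, (q.2 j i).natAbs) (fun _ _ => Nat.zero_le _) hqF
    have h2 : ∑ i : Fin n, (q.2 j i).natAbs ≤ ∑ j : Fin s, ∑ i : Fin n, (q.2 j i).natAbs :=
      Finset.single_le_sum (f := fun j => ∑ i : Fin n, (q.2 j i).natAbs)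
        (fun _ _ => Nat.zero_le _) (Finset.mem_univ j)
    have h3 : ((∑ i : Fin n, (q.2 j i).natAbs : ℕ) : ℤ) ≤ A := by exact_mod_cast h2.trans h1
    push_cast at h3
    exact h3
  let φ : (Fin n → ℤ) → (Fin s → ℤ) := fun x j => ∑ i, q.2 j i * x i
  let T : Finset (Fin s → ℤ) := Fintype.piFinset fun _ => Finset.Icc (-((A * H : ℕ) : ℤ)) ((A * H : ℕ) : ℤ)
  have hmaps : ∀ x ∈ S, φ x ∈ T := by
    intro x hx
    rw [Fintype.mem_piFinset]
    intro j
    rw [Finset.mem_Icc, ← abs_le]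
    calc |∑ i, q.2 j i * x i| ≤ ∑ i, |q.2 j i * x i| := Finset.abs_sum_le_sum_abs _ _
      _ ≤ ∑ i, |q.2 j i| * H := by
        refine Finset.sum_le_sum fun i _ => ?_
        rw [abs_mul]
        exact mul_le_mul_of_nonneg_left (hS x hx i) (abs_nonneg _)
      _ = (∑ i, |q.2 j i|) * H := by rw [Finset.sum_mul]
      _ ≤ ((A * H : ℕ) : ℤ) := by
        push_cast
        exact mul_le_mul_of_nonneg_right (hA j) (by positivity)
  let ι : (Fin n → ℤ) → (Fin n → k) := fun x j => ((x j : ℤ) : k)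
  have hι : Function.Injective ι := by
    intro x y hxy
    funext j
    have h0 : ((x j : ℤ) : k) = ((y j : ℤ) : k) := congrFun hxy j
    exact_mod_cast h0
  have hfib : ∀ y ∈ T, (S.filter fun x => φ x = y).card ≤ D ^ n := by
    intro y _
    rw [← Finset.card_image_of_injective _ hι]
    refine (fiber_count hd hg hq lam hlam Ψ hΨ _ ?_ (fun j => ((y j : ℤ) : k)) ?_).trans
      (Nat.pow_le_pow_left hD n)
    · intro z hz
      obtain ⟨x, hx, rfl⟩ := Finset.mem_image.1 hz
      exact hS0 x (Finset.mem_filter.1 hx).1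
    · intro z hz j
      obtain ⟨x, hx, rfl⟩ := Finset.mem_image.1 hz
      have h1 := congrFun (Finset.mem_filter.1 hx).2 j
      rw [← h1]
      simp [linF, φ, ι]
  have h1 := Finset.card_le_mul_card_image_of_maps_to hmaps (D ^ n) hfib
  refine h1.trans ?_
  rw [mul_assoc]
  refine Nat.mul_le_mul_left _ ?_
  have hT : T.card = (2 * (A * H) + 1) ^ s := by
    simp only [T, Fintype.card_piFinset, Int.card_Icc, Finset.prod_const, Finset.card_univ,
      Fintype.card_fin]
    congr 1
    omega
  rw [hT, ← mul_pow]
  refine Nat.pow_le_pow_left ?_ s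
  nlinarith

end AlgebraFour

section MultiForm

/-- polynomials all of whose monomials have degree `< e` -/
def LTd (S : Type) [CommRing S] (n e : ℕ) : Submodule S (MvPolynomial (Fin n) S) :=
  restrictSupport S {α | α.degree < e}

variable {S : Type} [CommRing S] {n : ℕ}

lemma mem_LTd {e : ℕ} {p : MvPolynomial (Fin n) S} :
    p ∈ LTd S n e ↔ ∀ α, coeff α p ≠ 0 → α.degree < e := by
  unfold LTd
  rw [mem_restrictSupport_iff]
  constructor
  · intro h α hα
    exact h (by simpa using hα)
  · intro h α hα
    exact h α (by simpa using hα)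

lemma LTd_mono {e e' : ℕ} (h : e ≤ e') {p : MvPolynomial (Fin n) S} (hp : p ∈ LTd S n e) :
    p ∈ LTd S n e' := mem_LTd.2 fun α hα => (mem_LTd.1 hp α hα).trans_le h

lemma LTd_zero {p : MvPolynomial (Fin n) S} (hp : p ∈ LTd S n 0) : p = 0 := by
  ext α
  by_contra h
  exact absurd (mem_LTd.1 hp α h) (by simp)

lemma LTd_X_mul {e : ℕ} (i : Fin n) {p : MvPolynomial (Fin n) S} (hp : p ∈ LTd S n e) :
    X i * p ∈ LTd S n (e + 1) := by
  classical
  rw [mem_LTd] at hp ⊢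
  intro α hα
  rw [coeff_X_mul'] at hα
  split_ifs at hα with h
  · have h1 := hp _ hα
    have hle : Finsupp.single i 1 ≤ α := by
      rw [Finsupp.single_le_iff]
      have := Finsupp.mem_support_iff.1 h
      omega
    obtain ⟨β, rfl⟩ := exists_add_of_le hle
    rw [add_tsub_cancel_left] at h1
    rw [map_add, Finsupp.degree_single]; omega
  · exact absurd rfl hα

lemma LTd_C_mul {e : ℕ} (a : S) {p : MvPolynomial (Fin n) S} (hp : p ∈ LTd S n e) :
    C a * p ∈ LTd S n e := by
  rw [← smul_eq_C_mul]; exact Submodule.smul_mem _ _ hp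

lemma LTd_of_hom {e : ℕ} {p : MvPolynomial (Fin n) S} (hp : p.IsHomogeneous e) :
    p ∈ LTd S n (e + 1) := by
  rw [mem_LTd]
  intro α hα
  by_contra h
  exact hα (hp.coeff_eq_zero (by omega))

lemma totalDegree_lt_of_LTd {e : ℕ} (he : 1 ≤ e) {p : MvPolynomial (Fin n) S}
    (hp : p ∈ LTd S n e) : p.totalDegree < e := by
  rw [totalDegree, Finset.sup_lt_iff (by rw [bot_eq_zero]; omega)]
  intro α hα
  exact mem_LTd.1 hp α (by simpa using hα)

lemma LTd_of_totalDegree {e : ℕ} {p : MvPolynomial (Fin n) S}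
    (hp : p.totalDegree ≤ e) : p ∈ LTd S n (e + 1) := by
  rw [mem_LTd]
  intro α hα
  have := le_totalDegree (p := p) (s := α) (by simpa using hα)
  exact Nat.lt_succ_of_le (le_trans this hp)

lemma coeff_pd (i : Fin n) (p : MvPolynomial (Fin n) S) (α : Fin n →₀ ℕ) :
    coeff α (pderiv i p) = coeff (α + Finsupp.single i 1) p * (α i + 1) := by
  classical
  induction p using MvPolynomial.induction_on' with
  | monomial β a =>
    rw [pderiv_monomial, coeff_monomial, coeff_monomial]
    by_cases h : β = α + Finsupp.single i 1
    · subst h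
      simp
    · rw [if_neg h, zero_mul]
      split_ifs with h2
      · have h3 : β i = 0 := by
          by_contra h0
          apply h
          rw [← h2, tsub_add_cancel_of_le]
          rw [Finsupp.single_le_iff]; omega
        simp [h3]
      · rfl
  | add p q hp hq => rw [map_add, coeff_add, coeff_add, hp, hq, add_mul]

lemma LTd_pderiv {e : ℕ} (i : Fin n) {p : MvPolynomial (Fin n) S} (hp : p ∈ LTd S n (e + 1)) :
    pderiv i p ∈ LTd S n e := by
  rw [mem_LTd] at hp ⊢
  intro α hα
  rw [coeff_pd] at hα
  have := hp (α + Finsupp.single i 1) (fun h => hα (by rw [h, zero_mul]))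
  rw [map_add, Finsupp.degree_single] at this; omega

/-- multilinear form attached to a polynomial -/
def MM : (m : ℕ) → (Fin m → Fin n → S) → MvPolynomial (Fin n) S → S
  | 0, _, q => constantCoeff q
  | m + 1, h, q => ∑ j, h 0 j * MM m (Fin.tail h) (pderiv j q)

lemma MM_add (m : ℕ) (h : Fin m → Fin n → S) (p q : MvPolynomial (Fin n) S) :
    MM m h (p + q) = MM m h p + MM m h q := by
  induction m generalizing p q with
  | zero => simp [MM]
  | succ m ih => simp [MM, ih, mul_add, Finset.sum_add_distrib]

lemma MM_smul (m : ℕ) (h : Fin m → Fin n → S) (a : S) (q : MvPolynomial (Fin n) S) :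
    MM m h (a • q) = a * MM m h q := by
  induction m generalizing q with
  | zero => simp [MM]
  | succ m ih =>
    simp only [MM, Derivation.map_smul, ih, Finset.mul_sum]
    exact Finset.sum_congr rfl fun j _ => by ring

def MMlin (m : ℕ) (h : Fin m → Fin n → S) : MvPolynomial (Fin n) S →ₗ[S] S where
  toFun := MM m h
  map_add' := MM_add m h
  map_smul' := MM_smul m h

lemma MM_sum {ι : Type} (s : Finset ι) (m : ℕ) (h : Fin m → Fin n → S)
    (q : ι → MvPolynomial (Fin n) S) : MM m h (∑ i ∈ s, q i) = ∑ i ∈ s, MM m h (q i) :=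
  map_sum (MMlin m h) q s

lemma MM_zero (m : ℕ) (h : Fin m → Fin n → S) : MM m h 0 = 0 := map_zero (MMlin m h)

lemma MM_eq_zero (m : ℕ) (h : Fin m → Fin n → S) {p : MvPolynomial (Fin n) S}
    (hp : p ∈ LTd S n m) : MM m h p = 0 := by
  induction m generalizing p with
  | zero => rw [LTd_zero hp, MM_zero]
  | succ m ih =>
    exact Finset.sum_eq_zero fun j _ => by rw [ih _ (LTd_pderiv j hp), mul_zero]

lemma MM_map {T : Type} [CommRing T] (φ : S →+* T) (m : ℕ) (h : Fin m → Fin n → S)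
    (q : MvPolynomial (Fin n) S) :
    φ (MM m h q) = MM m (fun i j => φ (h i j)) (MvPolynomial.map φ q) := by
  induction m generalizing q with
  | zero => simp [MM]
  | succ m ih =>
    simp only [MM, map_sum, map_mul, ih, pderiv_map]
    rfl

lemma MM_cons_sub (m : ℕ) (h h' : Fin n → S) (t : Fin m → Fin n → S)
    (q : MvPolynomial (Fin n) S) :
    MM (m + 1) (Fin.cons (h - h') t) q =
      MM (m + 1) (Fin.cons h t) q - MM (m + 1) (Fin.cons h' t) q := by
  simp [MM, sub_mul, Finset.sum_sub_distrib]

lemma MM_cons (m : ℕ) (h : Fin n → S) (t : Fin m → Fin n → S)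
    (q : MvPolynomial (Fin n) S) :
    MM (m + 1) (Fin.cons h t) q = ∑ j, h j * MM m t (pderiv j q) := by
  simp [MM]

lemma MM_smul_arg (m : ℕ) (a : S) (h : Fin m → Fin n → S) (q : MvPolynomial (Fin n) S) :
    MM m (fun i j => a * h i j) q = a ^ m * MM m h q := by
  induction m generalizing q with
  | zero => simp [MM]
  | succ m ih =>
    simp only [MM]
    have : ∀ j, MM m (Fin.tail fun i j => a * h i j) (pderiv j q) =
      a ^ m * MM m (Fin.tail h) (pderiv j q) := fun j => ih (Fin.tail h) _
    simp only [this, Finset.mul_sum]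
    exact Finset.sum_congr rfl fun j _ => by ring

/-- polarization -/
lemma MM_polar (e : ℕ) (c : Fin e → Fin n → S) (q : MvPolynomial (Fin n) S)
    (hq : q.IsHomogeneous e) :
    MM e (fun i j => X j + C (c i j)) (MvPolynomial.map C q) - C ((e.factorial : ℕ) : S) * q ∈
      LTd S n e := by
  induction e generalizing q with
  | zero =>
    have h1 := hq
    rw [← totalDegree_zero_iff_isHomogeneous, totalDegree_eq_zero_iff_eq_C] at h1
    rw [h1]
    simp [MM]
  | succ e ih =>
    let r : Fin n → MvPolynomial (Fin n) S := fun j =>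
      MM e (Fin.tail fun i j => X j + C (c i j)) (MvPolynomial.map C (pderiv j q))
        - C ((e.factorial : ℕ) : S) * pderiv j q
    have hr : ∀ j, r j ∈ LTd S n e := fun j => ih (Fin.tail c) _ hq.pderiv
    have h1 : MM (e + 1) (fun i j => X j + C (c i j)) (MvPolynomial.map C q) =
        ∑ j, (X j + C (c 0 j)) * (r j + C ((e.factorial : ℕ) : S) * pderiv j q) := by
      simp only [MM]
      refine Finset.sum_congr rfl fun j _ => ?_
      simp only [r, pderiv_map, sub_add_cancel]
    have h2 : ∑ j, X j * pderiv j q = (e + 1) • q := hq.sum_X_mul_pderiv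
    have h3 : C (((e + 1).factorial : ℕ) : S) * q = C ((e.factorial : ℕ) : S) * ∑ j, X j * pderiv j q := by
      rw [h2, Nat.factorial_succ]
      simp
      ring
    rw [h1, h3, Finset.mul_sum, ← Finset.sum_sub_distrib]
    refine Submodule.sum_mem _ fun j _ => ?_
    have h4 : (X j + C (c 0 j)) * (r j + C ((e.factorial : ℕ) : S) * pderiv j q) -
        C ((e.factorial : ℕ) : S) * (X j * pderiv j q) =
        X j * r j + C (c 0 j) * r j + C (c 0 j) * (C ((e.factorial : ℕ) : S) * pderiv j q) := by
      ring
    rw [h4]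
    refine Submodule.add_mem _ (Submodule.add_mem _ (LTd_X_mul j (hr j))
      (LTd_C_mul _ (LTd_mono (Nat.le_succ e) (hr j)))) (LTd_C_mul _ (LTd_C_mul _ ?_))
    exact LTd_of_hom hq.pderiv

lemma MM_bound (d : ℕ) (B : ℤ) (m : ℕ) (h : Fin m → Fin n → ℤ) (hB : ∀ i j, |h i j| ≤ B)
    (hB0 : 0 ≤ B)
    (p : MvPolynomial (Fin n) ℤ) (hp : p ∈ LTd ℤ n (d + 1)) (Cb : ℝ)
    (hC : ∀ α, |((coeff α p : ℤ) : ℝ)| ≤ Cb) :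
    |((MM m h p : ℤ) : ℝ)| ≤ (n * B * d) ^ m * Cb := by
  have hCb : 0 ≤ Cb := (abs_nonneg _).trans (hC 0)
  have hBr : (0 : ℝ) ≤ B := by exact_mod_cast hB0
  induction m generalizing p Cb with
  | zero =>
    have h0 := hC 0
    simp only [MM, pow_zero, one_mul]
    exact h0
  | succ m ih =>
    simp only [MM]
    push_cast
    have h1 : ∀ j : Fin n, |((MM m (Fin.tail h) (pderiv j p) : ℤ) : ℝ)| ≤
        (n * B * d) ^ m * (d * Cb) := by
      intro j
      refine ih (Fin.tail h) (fun i j => hB _ _) _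
        (LTd_mono (Nat.le_succ _) (LTd_pderiv j hp)) _ ?_ (by positivity)
      intro α
      rw [coeff_pd]
      push_cast
      rw [abs_mul]
      by_cases h0 : coeff (α + Finsupp.single j 1) p = 0
      · rw [h0]; simp; positivity
      · have h2 := mem_LTd.1 hp _ h0
        rw [map_add, Finsupp.degree_single] at h2
        have h3 : α j + 1 ≤ d := by
          have := Finsupp.le_degree j α
          omega
        have h4 : |((α j : ℕ) : ℝ) + 1| ≤ d := by
          rw [abs_of_nonneg (by positivity)]
          exact_mod_cast h3
        calc _ ≤ Cb * d := mul_le_mul (hC _) h4 (abs_nonneg _) hCb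
          _ = _ := by ring
    calc |∑ j, (h 0 j : ℝ) * (MM m (Fin.tail h) (pderiv j p) : ℤ)|
        ≤ ∑ j, |(h 0 j : ℝ) * (MM m (Fin.tail h) (pderiv j p) : ℤ)| := Finset.abs_sum_le_sum_abs _ _
      _ ≤ ∑ j : Fin n, (B : ℝ) * ((n * B * d) ^ m * (d * Cb)) := by
        refine Finset.sum_le_sum fun j _ => ?_
        rw [abs_mul]
        refine mul_le_mul ?_ (h1 j) (abs_nonneg _) hBr
        exact_mod_cast hB 0 j
      _ = _ := by
        rw [Finset.sum_const, Finset.card_univ, Fintype.card_fin, nsmul_eq_mul]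
        ring

end MultiForm

section CountForm

lemma count_MM (k : Type) [Field k] [CharZero k] (n e s : ℕ) :
    ∃ c : ℕ, ∀ g : MvPolynomial (Fin n) ℤ, g.IsHomogeneous (e + 2) →
      ringKrullDim (MvPolynomial (Fin n) k ⧸
        Ideal.span (Set.range fun j : Fin n =>
          pderiv j (MvPolynomial.map (Int.castRingHom k) g))) ≤ ((s : ℕ∞) : WithBot ℕ∞) →
      ∀ Q : ℕ, 1 ≤ Q → ∀ S : Finset (Fin (e + 1) → Fin n → ℤ),
      (∀ h ∈ S, ∀ i j, |h i j| ≤ 2 * Q) →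
      (∀ h ∈ S, ∀ j, MM (e + 1) h (pderiv j g) = 0) → S.card ≤ c * Q ^ (n * e + s) := by
  classical
  obtain ⟨c, hc⟩ := count_zeros k n (e + 2) s (by omega)
  refine ⟨(c * 2 ^ s) * 9 ^ (n * e), ?_⟩
  intro g hg hdim Q hQ S hS hS0
  let φ : (Fin (e + 1) → Fin n → ℤ) → (Fin e → Fin n → ℤ) := fun h i j => h i.succ j - h 0 j
  let T : Finset (Fin e → Fin n → ℤ) := Fintype.piFinset fun _ => Fintype.piFinset fun _ =>
    Finset.Icc (-((4 * Q : ℕ) : ℤ)) ((4 * Q : ℕ) : ℤ)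
  have hmaps : ∀ h ∈ S, φ h ∈ T := by
    intro h hh
    rw [Fintype.mem_piFinset]
    intro i
    rw [Fintype.mem_piFinset]
    intro j
    rw [Finset.mem_Icc]
    have h1 := abs_le.1 (hS h hh i.succ j)
    have h2 := abs_le.1 (hS h hh 0 j)
    simp only [φ]
    push_cast
    constructor <;> linarith
  have hT : T.card = (8 * Q + 1) ^ (n * e) := by
    simp only [T, Fintype.card_piFinset, Int.card_Icc, Finset.prod_const, Finset.card_univ,
      Fintype.card_fin]
    rw [← pow_mul]
    congr 1
    omega
  have hfib : ∀ y ∈ T, (S.filter fun x => φ x = y).card ≤ c * (2 * Q) ^ s := by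
    intro y _
    have hinj : Set.InjOn (fun h : Fin (e + 1) → Fin n → ℤ => h 0)
        (S.filter fun x => φ x = y : Finset _) := by
      intro h hh h' hh' h0
      have e1 := (Finset.mem_filter.1 hh).2
      have e2 := (Finset.mem_filter.1 hh').2
      have h0' : h 0 = h' 0 := h0
      funext i
      refine Fin.cases h0' (fun i => ?_) i
      funext j
      have a1 : h i.succ j - h 0 j = y i j := congrFun (congrFun e1 i) j
      have a2 : h' i.succ j - h' 0 j = y i j := congrFun (congrFun e2 i) j
      rw [h0'] at a1
      linarith
    rw [← Finset.card_image_of_injOn hinj]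
    let cc : Fin (e + 1) → Fin n → k := Fin.cons 0 fun i j => ((y i j : ℤ) : k)
    let Ψ : Fin n → MvPolynomial (Fin n) k := fun i =>
      MM (e + 1) (fun a j => X j + C (cc a j))
        (MvPolynomial.map C (pderiv i (MvPolynomial.map (Int.castRingHom k) g)))
    have hgk : (MvPolynomial.map (Int.castRingHom k) g).IsHomogeneous (e + 2) := hg.map _
    refine hc _ hgk hdim (((e + 1).factorial : ℕ) : k)
      (by exact_mod_cast Nat.factorial_ne_zero _) Ψ ?_ (2 * Q) (by omega) _ ?_ ?_
    · intro i
      exact totalDegree_lt_of_LTd (by omega) (MM_polar (e + 1) cc _ hgk.pderiv)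
    · intro x hx j
      obtain ⟨h, hh, rfl⟩ := Finset.mem_image.1 hx
      have := hS h (Finset.mem_filter.1 hh).1 0 j
      push_cast
      exact this
    · intro x hx i
      obtain ⟨h, hh, rfl⟩ := Finset.mem_image.1 hx
      obtain ⟨hh1, hh2⟩ := Finset.mem_filter.1 hh
      simp only [Ψ]
      rw [MM_map]
      have e1 : (MvPolynomial.map (eval fun j => ((h 0 j : ℤ) : k)))
          (MvPolynomial.map C (pderiv i (MvPolynomial.map (Int.castRingHom k) g))) =
          pderiv i (MvPolynomial.map (Int.castRingHom k) g) := by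
        rw [MvPolynomial.map_map]
        have : (eval fun j => ((h 0 j : ℤ) : k)).comp C = RingHom.id k := by
          ext x; simp
        rw [this, MvPolynomial.map_id]
      have e2 : (fun (a : Fin (e + 1)) (j : Fin n) =>
          (eval fun j => ((h 0 j : ℤ) : k)) (X j + C (cc a j))) =
          fun a j => (Int.castRingHom k) (h a j) := by
        funext a j
        rw [map_add, eval_X, eval_C]
        refine Fin.cases ?_ (fun a => ?_) a
        · simp [cc]
        · have a1 : h a.succ j - h 0 j = y a j := congrFun (congrFun hh2 a) j
          simp only [cc, Fin.cons_succ]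
          rw [← a1]
          simp
      rw [e1, e2, pderiv_map, ← MM_map, hS0 h hh1 i, map_zero]
  have h1 := Finset.card_le_mul_card_image_of_maps_to hmaps _ hfib
  refine h1.trans ?_
  rw [hT]
  calc c * (2 * Q) ^ s * (8 * Q + 1) ^ (n * e) ≤ c * (2 * Q) ^ s * (9 * Q) ^ (n * e) := by
        gcongr; omega
    _ = _ := by rw [mul_pow, mul_pow, pow_add]; ring

end CountForm

section CramerStep

lemma det_updateCol_bound {R : ℕ} (A : Matrix (Fin R) (Fin R) ℝ) (y : Fin R → ℝ) (i : Fin R)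
    (X Y : ℝ) (hA : ∀ a b, |A a b| ≤ X) (hy : ∀ a, |y a| ≤ Y) :
    |(A.updateCol i y).det| ≤ R.factorial * (X ^ (R - 1) * Y) := by
  classical
  rw [Matrix.det_apply]
  refine (Finset.abs_sum_le_sum_abs _ _).trans ?_
  have h1 : ∀ σ ∈ (Finset.univ : Finset (Equiv.Perm (Fin R))),
      |Equiv.Perm.sign σ • ∏ j, (A.updateCol i y) (σ j) j| ≤ X ^ (R - 1) * Y := by
    intro σ _
    have h2 : |Equiv.Perm.sign σ • ∏ j, (A.updateCol i y) (σ j) j| =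
        ∏ j, |(A.updateCol i y) (σ j) j| := by
      rw [← Finset.abs_prod]
      rcases Int.units_eq_one_or (Equiv.Perm.sign σ) with h | h <;> simp [h]
    rw [h2, ← Finset.mul_prod_erase _ _ (Finset.mem_univ i), mul_comm]
    have hY : 0 ≤ Y := (abs_nonneg _).trans (hy i)
    refine mul_le_mul ?_ (by simpa using hy (σ i)) (abs_nonneg _)
      (pow_nonneg ((abs_nonneg _).trans (hA i i)) _)
    have h3 : (Finset.univ.erase i).card = R - 1 := by
      rw [Finset.card_erase_of_mem (Finset.mem_univ i), Finset.card_univ, Fintype.card_fin]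
    rw [← h3, ← Finset.prod_const]
    refine Finset.prod_le_prod (fun _ _ => abs_nonneg _) fun j hj => ?_
    rw [Matrix.updateCol_ne (Finset.ne_of_mem_erase hj)]
    exact hA _ _
  refine (Finset.sum_le_card_nsmul _ _ _ h1).trans ?_
  rw [Finset.card_univ, Fintype.card_perm, Fintype.card_fin, nsmul_eq_mul]

lemma cramer_alt {R : ℕ} (V : Set (Fin R → ℤ)) (γ : Fin R → ℝ) (X Y : ℝ)
    (hX : ∀ v ∈ V, ∀ i, |((v i : ℤ) : ℝ)| ≤ X) (hY : ∀ v ∈ V, |∑ i, γ i * ((v i : ℤ) : ℝ)| ≤ Y) :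
    (∃ b : Fin R → ℤ, b ≠ 0 ∧ ∀ v ∈ V, ∑ i, b i * v i = 0) ∨
      ∀ i, |γ i| ≤ R.factorial * (X ^ (R - 1) * Y) := by
  classical
  let ι : (Fin R → ℤ) → (Fin R → ℚ) := fun v i => ((v i : ℤ) : ℚ)
  by_cases hspan : Submodule.span ℚ (ι '' V) = ⊤
  · right
    obtain ⟨B, hBV, hBs, hBl⟩ := exists_linearIndependent ℚ (ι '' V)
    rw [hspan] at hBs
    let bas : Module.Basis B ℚ (Fin R → ℚ) := Module.Basis.mk hBl (by
      rw [Subtype.range_coe, hBs])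
    let e : B ≃ Fin R := bas.indexEquiv (Pi.basisFun ℚ (Fin R))
    have hw : ∀ a : Fin R, ∃ v ∈ V, ι v = (e.symm a).1 := fun a => hBV (e.symm a).2
    choose w hwV hw using hw
    let Aq : Matrix (Fin R) (Fin R) ℚ := Matrix.of fun a i => ((w a i : ℤ) : ℚ)
    have hli : LinearIndependent ℚ Aq.row := by
      have h1 : LinearIndependent ℚ (fun a => ((e.symm a).1 : Fin R → ℚ)) :=
        hBl.comp _ e.symm.injective
      convert h1 using 1
      funext a
      rw [← hw a]; rfl
    have hunit := Matrix.linearIndependent_rows_iff_isUnit.1 hli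
    rw [Matrix.isUnit_iff_isUnit_det, isUnit_iff_ne_zero] at hunit
    let Az : Matrix (Fin R) (Fin R) ℤ := Matrix.of w
    have hAq : Aq = (Int.castRingHom ℚ).mapMatrix Az := by
      ext a b; simp [Aq, Az]
    rw [hAq, ← RingHom.map_det] at hunit
    have hdz : Az.det ≠ 0 := by
      intro h; apply hunit; rw [h]; simp
    let A : Matrix (Fin R) (Fin R) ℝ := (Int.castRingHom ℝ).mapMatrix Az
    have hdA : A.det = ((Az.det : ℤ) : ℝ) := by
      simp only [A]; rw [← RingHom.map_det]; simp
    have hd1 : 1 ≤ |A.det| := by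
      rw [hdA]
      exact_mod_cast Int.one_le_abs hdz
    intro i
    have h2 : A.det * γ i = (A.updateCol i (A.mulVec γ)).det := by
      rw [← Matrix.cramer_apply, Matrix.cramer_eq_adjugate_mulVec, Matrix.mulVec_mulVec,
        Matrix.adjugate_mul, Matrix.smul_mulVec, Matrix.one_mulVec]
      simp
    have h3 := det_updateCol_bound A (A.mulVec γ) i X Y (fun a b => by
      simpa [A, Az] using hX (w a) (hwV a) b) (fun a => by
      have := hY (w a) (hwV a)
      convert this using 2
      simp [Matrix.mulVec, dotProduct, A, Az, mul_comm])
    rw [← h2, abs_mul] at h3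
    refine le_trans ?_ h3
    exact le_mul_of_one_le_left (abs_nonneg _) hd1
  · left
    obtain ⟨f, hf0, hf⟩ := Submodule.exists_le_ker_of_lt_top _ (lt_top_iff_ne_top.2 hspan)
    let a : Fin R → ℚ := fun i => f (Pi.single i 1)
    have hfa : ∀ x, f x = ∑ i, a i * x i := by
      intro x
      have := LinearMap.pi_apply_eq_sum_univ f x
      rw [this]
      refine Finset.sum_congr rfl fun i _ => ?_
      rw [smul_eq_mul, mul_comm]
      congr 2
      funext j
      simp [Pi.single_apply, eq_comm]
    obtain ⟨b, hb⟩ := IsLocalization.exist_integer_multiples_of_finite (nonZeroDivisors ℤ) a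
    choose z hz using hb
    have hz' : ∀ i, ((z i : ℤ) : ℚ) = (b : ℤ) * a i := fun i => by simpa using hz i
    have hb0 : ((b : ℤ) : ℚ) ≠ 0 := by
      have := nonZeroDivisors.coe_ne_zero b
      exact_mod_cast this
    refine ⟨z, ?_, ?_⟩
    · intro h0
      apply hf0
      ext i
      have h1 := hz' i
      rw [h0] at h1
      simp [hb0] at h1
      simpa [a] using h1
    · intro v hv
      have h1 : f (ι v) = 0 := hf (Submodule.subset_span ⟨v, hv, rfl⟩)
      rw [hfa] at h1
      have h2 : ((∑ i, z i * v i : ℤ) : ℚ) = (b : ℤ) * ∑ i, a i * ι v i := by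
        push_cast
        rw [Finset.mul_sum]
        refine Finset.sum_congr rfl fun i _ => ?_
        rw [hz']
        simp only [ι]; ring
      rw [h1, mul_zero] at h2
      exact_mod_cast h2

lemma cramer_forms (n R e : ℕ) :
    ∃ c1 : ℝ, 0 < c1 ∧ ∀ g : Fin R → MvPolynomial (Fin n) ℤ, (∀ i, (g i).IsHomogeneous (e + 2)) →
      ∀ Ct : ℝ, (∀ i α, |((coeff α (g i) : ℤ) : ℝ)| ≤ Ct) → ∀ Q : ℕ, 1 ≤ Q →
      ∀ (γ : Fin R → ℝ) (S : Finset (Fin (e + 1) → Fin n → ℤ)),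
      (∀ h ∈ S, ∀ i j, |h i j| ≤ 2 * Q) →
      (∀ h ∈ S, ∀ j, |∑ i, γ i * ((MM (e + 1) h (pderiv j (g i)) : ℤ) : ℝ)| ≤ (Q : ℝ) ^ (e + 1)) →
      (∃ i, c1 * Ct ^ (R - 1) * (Q : ℝ) ^ (R * (e + 1)) < |γ i|) →
      ∃ b : Fin R → ℤ, b ≠ 0 ∧ ∀ h ∈ S, ∀ j, MM (e + 1) h (pderiv j (∑ i, b i • g i)) = 0 := by
  let E : ℝ := (n * 2 * (e + 2)) ^ (e + 1) * (e + 2)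
  refine ⟨R.factorial * E ^ (R - 1) + 1, by positivity, ?_⟩
  intro g hg Ct hCt Q hQ γ S hS hS0 ⟨i0, hi0⟩
  have hR : 1 ≤ R := Nat.one_le_iff_ne_zero.2 (by rintro rfl; exact i0.elim0)
  have hCt0 : 0 ≤ Ct := (abs_nonneg _).trans (hCt i0 0)
  let V : Set (Fin R → ℤ) := {v | ∃ h ∈ S, ∃ j, v = fun i => MM (e + 1) h (pderiv j (g i))}
  have hVX : ∀ v ∈ V, ∀ i, |((v i : ℤ) : ℝ)| ≤ E * Ct * (Q : ℝ) ^ (e + 1) := by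
    rintro _ ⟨h, hh, j, rfl⟩ i
    have h1 := MM_bound (e + 2) (2 * Q) (e + 1) h (hS h hh) (by positivity) (pderiv j (g i))
      (LTd_mono (Nat.le_succ _) (LTd_pderiv j (LTd_of_hom (hg i)))) ((e + 2) * Ct) ?_
    · refine h1.trans (le_of_eq ?_)
      push_cast
      simp only [E]
      rw [show (n : ℝ) * (2 * (Q : ℝ)) * ((e : ℝ) + 2) = (n * 2 * (e + 2)) * Q by ring, mul_pow]
      ring
    · intro α
      rw [coeff_pd]
      push_cast
      rw [abs_mul]
      by_cases h0 : coeff (α + Finsupp.single j 1) (g i) = 0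
      · rw [h0]; simp; positivity
      · have h2 := mem_LTd.1 (LTd_of_hom (hg i)) _ h0
        rw [map_add, Finsupp.degree_single] at h2
        have h3 : α j + 1 ≤ e + 2 := by
          have := Finsupp.le_degree j α
          omega
        have h4 : |((α j : ℕ) : ℝ) + 1| ≤ e + 2 := by
          rw [abs_of_nonneg (by positivity)]
          exact_mod_cast h3
        calc _ ≤ Ct * (e + 2) := mul_le_mul (hCt _ _) h4 (abs_nonneg _) hCt0
          _ = _ := by ring
  have hVY : ∀ v ∈ V, |∑ i, γ i * ((v i : ℤ) : ℝ)| ≤ (Q : ℝ) ^ (e + 1) := by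
    rintro _ ⟨h, hh, j, rfl⟩
    exact hS0 h hh j
  rcases cramer_alt V γ (E * Ct * (Q : ℝ) ^ (e + 1)) ((Q : ℝ) ^ (e + 1)) hVX hVY with h | h
  · obtain ⟨b, hb0, hb⟩ := h
    refine ⟨b, hb0, fun h hh j => ?_⟩
    rw [map_sum, MM_sum, ← hb _ ⟨h, hh, j, rfl⟩]
    refine Finset.sum_congr rfl fun i _ => ?_
    rw [Derivation.map_smul, MM_smul]
  · exfalso
    have h1 := hi0.trans_le (h i0)
    have hpow : (Q : ℝ) ^ (R * (e + 1)) = ((Q : ℝ) ^ (e + 1)) ^ (R - 1) * (Q : ℝ) ^ (e + 1) := by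
      rw [← pow_succ, Nat.sub_add_cancel hR, ← pow_mul, mul_comm]
    have h2 : (R.factorial : ℝ) * ((E * Ct * (Q : ℝ) ^ (e + 1)) ^ (R - 1) * (Q : ℝ) ^ (e + 1)) =
        R.factorial * E ^ (R - 1) * (Ct ^ (R - 1) * (Q : ℝ) ^ (R * (e + 1))) := by
      rw [hpow, mul_pow, mul_pow]; ring
    rw [h2] at h1
    have h3 : 0 ≤ Ct ^ (R - 1) * (Q : ℝ) ^ (R * (e + 1)) := by positivity
    nlinarith

end CramerStep

section Differencing
variable {n : ℕ}

/-- finite difference -/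
def dl (h : Fin n → ℝ) : MvPolynomial (Fin n) ℝ →ₗ[ℝ] MvPolynomial (Fin n) ℝ :=
  (aeval (R := ℝ) (fun j => X j + C (h j) : Fin n → MvPolynomial (Fin n) ℝ)).toLinearMap
    - LinearMap.id

/-- directional derivative -/
def Dh (h : Fin n → ℝ) : MvPolynomial (Fin n) ℝ →ₗ[ℝ] MvPolynomial (Fin n) ℝ :=
  ∑ j, h j • (pderiv j : Derivation ℝ (MvPolynomial (Fin n) ℝ) (MvPolynomial (Fin n) ℝ)).toLinearMap

lemma dl_apply (h : Fin n → ℝ) (q : MvPolynomial (Fin n) ℝ) :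
    dl h q = aeval (R := ℝ) (fun j => X j + C (h j) : Fin n → MvPolynomial (Fin n) ℝ) q - q := rfl

lemma Dh_apply (h : Fin n → ℝ) (q : MvPolynomial (Fin n) ℝ) :
    Dh h q = ∑ j, h j • pderiv j q := by
  simp [Dh]

lemma eval_dl (h x : Fin n → ℝ) (q : MvPolynomial (Fin n) ℝ) :
    eval x (dl h q) = eval (x + h) q - eval x q := by
  rw [dl_apply, map_sub]
  congr 1
  rw [← MvPolynomial.coe_aeval_eq_eval, ← MvPolynomial.coe_aeval_eq_eval]
  have : ((aeval x : MvPolynomial (Fin n) ℝ →ₐ[ℝ] ℝ).comp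
      (aeval (R := ℝ) (fun j => X j + C (h j) : Fin n → MvPolynomial (Fin n) ℝ))) =
      aeval (x + h) := by
    ext j; simp
  exact DFunLike.congr_fun this q

lemma dl_X_mul (h : Fin n → ℝ) (i : Fin n) (p : MvPolynomial (Fin n) ℝ) :
    dl h (X i * p) = X i * dl h p + C (h i) * p + C (h i) * dl h p := by
  simp only [dl_apply, map_mul, aeval_X]
  ring

lemma Dh_X_mul (h : Fin n → ℝ) (i : Fin n) (p : MvPolynomial (Fin n) ℝ) :
    Dh h (X i * p) = X i * Dh h p + C (h i) * p := by
  classical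
  simp only [Dh_apply, Derivation.leibniz, pderiv_X, smul_eq_mul, smul_add, Finset.sum_add_distrib,
    Finset.mul_sum]
  congr 1
  · exact Finset.sum_congr rfl fun j _ => by rw [mul_smul_comm]
  · rw [Finset.sum_eq_single i]
    · simp [smul_eq_C_mul, mul_comm]
    · intro b _ hb; simp [Pi.single_apply, hb.symm]
    · simp

lemma dl_monomial (h : Fin n → ℝ) (N : ℕ) : ∀ α : Fin n →₀ ℕ, α.degree = N →
    dl h (monomial α 1) ∈ LTd ℝ n N ∧
      dl h (monomial α 1) - Dh h (monomial α 1) ∈ LTd ℝ n (N - 1) := by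
  induction N with
  | zero =>
    intro α hα
    have : α = 0 := (Finsupp.degree_eq_zero_iff α).1 hα
    subst this
    have h1 : dl h (monomial 0 1) = 0 := by
      rw [dl_apply]; simp
    have h2 : Dh h (monomial 0 1) = 0 := by
      rw [Dh_apply]; simp
    rw [h1, h2]; simp
  | succ N ih =>
    intro α hα
    have : α ≠ 0 := by rintro rfl; simp at hα
    obtain ⟨i, hi⟩ := Finsupp.ne_iff.1 this
    have hle : Finsupp.single i 1 ≤ α := by
      rw [Finsupp.single_le_iff]; simp at hi; omega
    obtain ⟨β, rfl⟩ := exists_add_of_le hle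
    have hβ : β.degree = N := by
      rw [map_add, Finsupp.degree_single] at hα; omega
    obtain ⟨h1, h2⟩ := ih β hβ
    have h3 : monomial (Finsupp.single i 1 + β) (1 : ℝ) = X i * monomial β 1 := by
      rw [X, monomial_mul, one_mul]
    have h4 : monomial β (1 : ℝ) ∈ LTd ℝ n (N + 1) := LTd_of_hom (isHomogeneous_monomial 1 hβ)
    rw [h3, dl_X_mul, Dh_X_mul]
    refine ⟨?_, ?_⟩
    · exact Submodule.add_mem _ (Submodule.add_mem _ (LTd_X_mul i h1) (LTd_C_mul _ h4))
        (LTd_C_mul _ (LTd_mono (Nat.le_succ _) h1))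
    · have h5 : X i * dl h (monomial β 1) + C (h i) * monomial β 1 + C (h i) * dl h (monomial β 1) -
          (X i * Dh h (monomial β 1) + C (h i) * monomial β 1) =
          X i * (dl h (monomial β 1) - Dh h (monomial β 1)) + C (h i) * dl h (monomial β 1) := by
        ring
      rw [h5]
      refine Submodule.add_mem _ ?_ (LTd_C_mul _ h1)
      rcases Nat.eq_zero_or_pos N with h0 | h0
      · subst h0
        rw [LTd_zero h2, mul_zero]; exact Submodule.zero_mem _
      · have := LTd_X_mul i h2
        rw [Nat.sub_add_cancel h0] at this
        exact this

lemma dl_mem (h : Fin n → ℝ) (e : ℕ) (q : MvPolynomial (Fin n) ℝ) (hq : q ∈ LTd ℝ n (e + 1)) :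
    dl h q ∈ LTd ℝ n e ∧ dl h q - Dh h q ∈ LTd ℝ n (e - 1) := by
  have h2 : ∀ β, monomial β (coeff β q) = coeff β q • monomial β 1 := by
    intro β
    rw [smul_monomial]; simp
  have hdeg : ∀ β ∈ q.support, β.degree ≤ e := fun β hβ =>
    Nat.le_of_lt_succ (mem_LTd.1 hq β (by simpa using hβ))
  have h3 : q = ∑ β ∈ q.support, coeff β q • monomial β 1 := by
    conv_lhs => rw [q.as_sum]
    exact Finset.sum_congr rfl fun β _ => h2 β
  have h4 : dl h q = ∑ β ∈ q.support, coeff β q • dl h (monomial β 1) := by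
    conv_lhs => rw [h3]
    simp only [map_sum, map_smul]
  have h5 : Dh h q = ∑ β ∈ q.support, coeff β q • Dh h (monomial β 1) := by
    conv_lhs => rw [h3]
    simp only [map_sum, map_smul]
  constructor
  · rw [h4]
    exact Submodule.sum_mem _ fun β hβ => Submodule.smul_mem _ _
      (LTd_mono (hdeg β hβ) (dl_monomial h _ β rfl).1)
  · rw [h4, h5, ← Finset.sum_sub_distrib]
    refine Submodule.sum_mem _ fun β hβ => ?_
    rw [← smul_sub]
    exact Submodule.smul_mem _ _
      (LTd_mono (Nat.sub_le_sub_right (hdeg β hβ) 1) (dl_monomial h _ β rfl).2)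

lemma pd_comm (i j : Fin n) (q : MvPolynomial (Fin n) ℝ) :
    pderiv i (pderiv j q) = pderiv j (pderiv i q) := by
  classical
  by_cases h : i = j
  · rw [h]
  · ext α
    rw [coeff_pd, coeff_pd, coeff_pd, coeff_pd, add_assoc, add_assoc,
      add_comm (Finsupp.single i 1) (Finsupp.single j 1)]
    simp [Finsupp.single_apply, h, Ne.symm h]
    ring

lemma MM_dl (m : ℕ) (h : Fin n → ℝ) (t : Fin m → Fin n → ℝ) (q : MvPolynomial (Fin n) ℝ)
    (hq : q ∈ LTd ℝ n (m + 3)) (j : Fin n) :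
    MM m t (pderiv j (dl h q)) = MM (m + 1) (Fin.cons h t) (pderiv j q) := by
  have h1 : dl h q = Dh h q + (dl h q - Dh h q) := by ring
  have h2 : dl h q - Dh h q ∈ LTd ℝ n (m + 1) := (dl_mem h (m + 2) q hq).2
  rw [h1, map_add, MM_add, MM_eq_zero m t (LTd_pderiv j h2), add_zero, Dh_apply, map_sum, MM_sum,
    MM_cons]
  refine Finset.sum_congr rfl fun i _ => ?_
  rw [Derivation.map_smul, MM_smul, pd_comm]

lemma lin_eval (q : MvPolynomial (Fin n) ℝ) (hq : q ∈ LTd ℝ n 2) (x : Fin n → ℝ) :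
    eval x q = coeff 0 q + ∑ j, constantCoeff (pderiv j q) * x j := by
  classical
  have h0 : ∀ j, constantCoeff (pderiv j q) = coeff (Finsupp.single j 1) q := by
    intro j
    rw [constantCoeff_eq, coeff_pd]; simp
  have h1 : q = C (coeff 0 q) + ∑ j, C (coeff (Finsupp.single j 1) q) * X j := by
    ext α
    rw [coeff_add, coeff_sum, coeff_C]
    simp only [coeff_C_mul, coeff_X]
    by_cases hα : α = 0
    · subst hα
      simp [Finsupp.single_eq_zero]
    · rw [if_neg (Ne.symm hα), zero_add]
      obtain ⟨i, hi⟩ := Finsupp.ne_iff.1 hα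
      have hle : Finsupp.single i 1 ≤ α := by
        rw [Finsupp.single_le_iff]; simp at hi; omega
      obtain ⟨β, rfl⟩ := exists_add_of_le hle
      by_cases hβ : β = 0
      · subst hβ
        rw [add_zero, Finset.sum_eq_single i]
        · simp
        · intro b _ hb
          rw [if_neg, mul_zero]
          intro h
          exact hb ((Finsupp.single_left_injective one_ne_zero) h)
        · simp
      · have hd : 1 ≤ β.degree := Nat.one_le_iff_ne_zero.2 (fun h => hβ ((Finsupp.degree_eq_zero_iff β).1 h))
        have h2 : coeff (Finsupp.single i 1 + β) q = 0 := by
          by_contra h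
          have := mem_LTd.1 hq _ h
          rw [map_add, Finsupp.degree_single] at this
          omega
        rw [h2, eq_comm]
        refine Finset.sum_eq_zero fun j _ => ?_
        rw [if_neg, mul_zero]
        intro h
        have := congrArg Finsupp.degree h
        rw [map_add, Finsupp.degree_single, Finsupp.degree_single] at this
        omega
  conv_lhs => rw [h1]
  simp [h0]

end Differencing

section OscOne

lemma norm_eC (t : ℝ) : ‖eC t‖ = 1 := by
  unfold eC
  rw [show 2 * (Real.pi : ℂ) * Complex.I * (t : ℂ) = ((2 * Real.pi * t : ℝ) : ℂ) * Complex.I by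
    push_cast; ring]
  exact Complex.norm_exp_ofReal_mul_I _

lemma eC_add (s t : ℝ) : eC (s + t) = eC s * eC t := by
  unfold eC
  rw [← Complex.exp_add]
  congr 1
  push_cast; ring

lemma eC_zero : eC 0 = 1 := by simp [eC]

lemma conj_eC (t : ℝ) : (starRingEnd ℂ) (eC t) = eC (-t) := by
  unfold eC
  rw [← Complex.exp_conj]
  congr 1
  simp only [map_mul, Complex.conj_I, Complex.conj_ofReal, Complex.ofReal_neg]
  rw [map_ofNat]
  ring

lemma eC_sub (s t : ℝ) : eC (s - t) = eC s * (starRingEnd ℂ) (eC t) := by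
  rw [conj_eC, ← eC_add]; rfl

lemma eC_sum {ι : Type} (s : Finset ι) (f : ι → ℝ) : eC (∑ i ∈ s, f i) = ∏ i ∈ s, eC (f i) := by
  classical
  induction s using Finset.induction_on with
  | empty => simp [eC_zero]
  | insert a s ha ih => rw [Finset.sum_insert ha, Finset.prod_insert ha, eC_add, ih]

lemma continuous_eC : Continuous eC := by
  unfold eC; fun_prop

lemma osc_one (a b lam : ℝ) (hab : b - a ≤ 1) :
    ‖∫ x in Set.Icc a b, eC (lam * x)‖ ≤ (max 1 |lam|)⁻¹ := by
  have hone : ‖∫ x in Set.Icc a b, eC (lam * x)‖ ≤ 1 := by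
    have h1 := norm_setIntegral_le_of_norm_le_const (μ := volume) (s := Set.Icc a b) (C := 1)
      (f := fun x => eC (lam * x)) (by simp) (fun x _ => (norm_eC _).le)
    refine h1.trans ?_
    rw [one_mul, Measure.real, Real.volume_Icc]
    rcases le_total 0 (b - a) with h | h
    · rw [ENNReal.toReal_ofReal h]; exact hab
    · rw [ENNReal.ofReal_of_nonpos h]; simp
  by_cases hl : |lam| ≤ 1
  · rw [max_eq_left hl, inv_one]; exact hone
  push Not at hl
  rw [max_eq_right hl.le]
  rcases lt_or_ge b a with h | h
  · rw [Set.Icc_eq_empty (not_le.2 h)]; simp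
  have hl0 : lam ≠ 0 := by rintro rfl; simp at hl; linarith
  rw [integral_Icc_eq_integral_Ioc, ← intervalIntegral.integral_of_le h]
  have hc : (2 * (Real.pi : ℂ) * Complex.I * lam) ≠ 0 := by
    simp [Real.pi_ne_zero, hl0]
  have h2 : ∀ x : ℝ, eC (lam * x) = Complex.exp ((2 * (Real.pi : ℂ) * Complex.I * lam) * x) := by
    intro x; unfold eC; congr 1; push_cast; ring
  have h3 : ∀ x : ℝ, ‖Complex.exp ((2 * (Real.pi : ℂ) * Complex.I * lam) * x)‖ = 1 := by
    intro x; rw [← h2, norm_eC]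
  simp_rw [h2]
  rw [integral_exp_mul_complex hc, norm_div]
  have h4 : ‖2 * (Real.pi : ℂ) * Complex.I * lam‖ = 2 * Real.pi * |lam| := by
    simp [abs_of_pos Real.pi_pos]
  rw [h4]
  have h5 : ‖Complex.exp (2 * (Real.pi : ℂ) * Complex.I * lam * b) -
      Complex.exp (2 * (Real.pi : ℂ) * Complex.I * lam * a)‖ ≤ 2 := by
    refine (norm_sub_le _ _).trans ?_
    rw [h3, h3]; norm_num
  have hlp : 0 < |lam| := by linarith
  have hpi := Real.pi_gt_three
  rw [div_le_iff₀ (by positivity)]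
  refine h5.trans ?_
  rw [show |lam|⁻¹ * (2 * Real.pi * |lam|) = 2 * Real.pi * (|lam|⁻¹ * |lam|) by ring,
    inv_mul_cancel₀ hlp.ne']
  linarith

variable {n : ℕ}

def OI (a b : Fin n → ℝ) (q : MvPolynomial (Fin n) ℝ) : ℂ :=
  ∫ x in Set.Icc a b, eC (eval x q)

lemma osc_lin (a b : Fin n → ℝ) (hab : ∀ j, b j - a j ≤ 1) (q : MvPolynomial (Fin n) ℝ)
    (hq : q ∈ LTd ℝ n 2) :
    ‖OI a b q‖ ≤ ∏ j, (max 1 |constantCoeff (pderiv j q)|)⁻¹ := by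
  unfold OI
  simp_rw [lin_eval q hq, eC_add, eC_sum]
  rw [integral_const_mul, norm_mul, norm_eC, one_mul]
  have h1 : (volume : Measure (Fin n → ℝ)).restrict (Set.Icc a b) =
      Measure.pi fun j => (volume : Measure ℝ).restrict (Set.Icc (a j) (b j)) := by
    rw [← Set.pi_univ_Icc, volume_pi, Measure.restrict_pi_pi]
  rw [h1, integral_fintype_prod_eq_prod (𝕜 := ℂ)
    (f := fun j (x : ℝ) => eC (constantCoeff (pderiv j q) * x)), norm_prod]
  exact Finset.prod_le_prod (fun _ _ => norm_nonneg _) fun j _ => osc_one _ _ _ (hab j)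

end OscOne

section VanDerCorput
variable {n : ℕ}

lemma cs_set {α : Type} [MeasurableSpace α] {μ : Measure α} (E : Set α) (hE : μ E ≠ ⊤)
    (f : α → ℂ) (hf : IntegrableOn f E μ) (hf2 : IntegrableOn (fun x => ‖f x‖ ^ 2) E μ) :
    ‖∫ x in E, f x ∂μ‖ ^ 2 ≤ μ.real E * ∫ x in E, ‖f x‖ ^ 2 ∂μ := by
  set A := ∫ x in E, ‖f x‖ ∂μ with hA
  set B := ∫ x in E, ‖f x‖ ^ 2 ∂μ with hB
  set V := μ.real E with hV
  have hA0 : ‖∫ x in E, f x ∂μ‖ ≤ A := norm_integral_le_integral_norm _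
  have h1 : ‖∫ x in E, f x ∂μ‖ ^ 2 ≤ A ^ 2 := pow_le_pow_left₀ (norm_nonneg _) hA0 2
  refine h1.trans ?_
  have hV0 : 0 ≤ V := measureReal_nonneg
  have key : ∀ t : ℝ, 0 ≤ B - 2 * t * A + t ^ 2 * V := by
    intro t
    have h2 : 0 ≤ ∫ x in E, (‖f x‖ - t) ^ 2 ∂μ := integral_nonneg fun x => sq_nonneg _
    have h3 : ∫ x in E, (‖f x‖ - t) ^ 2 ∂μ = B - 2 * t * A + t ^ 2 * V := by
      have : ∀ x, (‖f x‖ - t) ^ 2 = ‖f x‖ ^ 2 - 2 * t * ‖f x‖ + t ^ 2 := fun x => by ring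
      simp_rw [this]
      have hi1 : IntegrableOn (fun x => 2 * t * ‖f x‖) E μ := hf.norm.const_mul _
      have hi2 : IntegrableOn (fun _ => t ^ 2) E μ := integrableOn_const hE
      have hi3 : IntegrableOn (fun x => ‖f x‖ ^ 2 - 2 * t * ‖f x‖) E μ := hf2.sub hi1
      rw [integral_add hi3 hi2, integral_sub hf2 hi1, integral_const_mul,
        setIntegral_const, smul_eq_mul, mul_comm V]
    rw [← h3]; exact h2
  rcases hV0.eq_or_lt with h0 | h0
  · have hm : μ E = 0 := by
      have h5 : μ.real E = 0 := by rw [← hV]; exact h0.symm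
      rcases (Measure.real_def μ E ▸ ENNReal.toReal_eq_zero_iff _).1 h5 with h | h
      · exact h
      · exact absurd h hE
    have : A = 0 := by
      rw [hA, Measure.restrict_eq_zero.2 hm]; simp
    rw [this, ← h0]; simp
  · have h6 := key (A / V)
    have h7 : B - 2 * (A / V) * A + (A / V) ^ 2 * V = B - A ^ 2 / V := by
      field_simp; ring
    rw [h7, sub_nonneg, div_le_iff₀ h0] at h6
    linarith

/-- integer shifts -/
abbrev HB (n Q : ℕ) : Type :=
  {h : Fin n → ℤ // h ∈ Fintype.piFinset fun _ : Fin n => Finset.Icc (-(Q : ℤ)) (Q : ℤ)}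

def sc (Q : ℕ) (h : Fin n → ℤ) : Fin n → ℝ := fun j => (h j : ℝ) / Q

lemma HB_card (n Q : ℕ) : Fintype.card (HB n Q) = (2 * Q + 1) ^ n := by
  rw [Fintype.card_coe]
  simp only [Fintype.card_piFinset, Int.card_Icc, Finset.prod_const, Finset.card_univ,
      Fintype.card_fin]
  congr 1
  omega

def FF (a b : Fin n → ℝ) (q : MvPolynomial (Fin n) ℝ) : (Fin n → ℝ) → ℂ :=
  (Set.Icc a b).indicator fun x => eC (eval x q)

lemma cont_eCeval (q : MvPolynomial (Fin n) ℝ) : Continuous fun x : Fin n → ℝ => eC (eval x q) :=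
  continuous_eC.comp (MvPolynomial.continuous_eval q)

lemma FF_integrable (a b : Fin n → ℝ) (q : MvPolynomial (Fin n) ℝ) : Integrable (FF a b q) := by
  unfold FF
  rw [integrable_indicator_iff measurableSet_Icc]
  exact (cont_eCeval q).continuousOn.integrableOn_compact isCompact_Icc

lemma FF_norm (a b : Fin n → ℝ) (q : MvPolynomial (Fin n) ℝ) (x : Fin n → ℝ) :
    ‖FF a b q x‖ ≤ 1 := by
  unfold FF
  refine (norm_indicator_le_norm_self _ _).trans ?_
  rw [norm_eC]

lemma FF_integral (a b : Fin n → ℝ) (q : MvPolynomial (Fin n) ℝ) :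
    ∫ x, FF a b q x = OI a b q := by
  unfold FF OI
  rw [integral_indicator measurableSet_Icc]

lemma FF_corr (a b h : Fin n → ℝ) (q : MvPolynomial (Fin n) ℝ) :
    ∫ x, FF a b q (x + h) * (starRingEnd ℂ) (FF a b q x) =
      OI (a ⊔ (a - h)) (b ⊓ (b - h)) (dl h q) := by
  rw [← FF_integral]
  congr 1
  funext x
  unfold FF
  have hiff : x ∈ Set.Icc (a ⊔ (a - h)) (b ⊓ (b - h)) ↔ x + h ∈ Set.Icc a b ∧ x ∈ Set.Icc a b := by
    simp only [Set.mem_Icc, sup_le_iff, le_inf_iff, sub_le_iff_le_add, le_sub_iff_add_le]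
    tauto
  by_cases h1 : x ∈ Set.Icc a b
  · by_cases h2 : x + h ∈ Set.Icc a b
    · rw [Set.indicator_of_mem h1, Set.indicator_of_mem h2, Set.indicator_of_mem (hiff.2 ⟨h2, h1⟩),
        eval_dl, eC_sub]
    · rw [Set.indicator_of_notMem h2, Set.indicator_of_notMem (fun h => h2 (hiff.1 h).1), zero_mul]
  · rw [Set.indicator_of_notMem h1, Set.indicator_of_notMem (fun h => h1 (hiff.1 h).2), map_zero,
      mul_zero]

lemma FF_prod_integrable (a b u v : Fin n → ℝ) (q : MvPolynomial (Fin n) ℝ) :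
    Integrable fun x => FF a b q (x + u) * (starRingEnd ℂ) (FF a b q (x + v)) := by
  have h1 := (FF_integrable a b q).comp_add_right u
  have h2 := (FF_integrable a b q).comp_add_right v
  refine h1.mul_bdd (c := 1) ?_ ?_
  · exact (RCLike.continuous_conj (K := ℂ)).comp_aestronglyMeasurable h2.aestronglyMeasurable
  · refine Eventually.of_forall fun x => ?_
    rw [RCLike.norm_conj]; exact FF_norm _ _ _ _

lemma vdC (Q : ℕ) (hQ : 1 ≤ Q) (a b : Fin n → ℝ) (ha : ∀ j, -1 ≤ a j) (hb : ∀ j, b j ≤ 1)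
    (q : MvPolynomial (Fin n) ℝ) :
    ‖OI a b q‖ ^ 2 ≤ 3 ^ n * ((Q : ℝ) ^ n)⁻¹ * ∑ h : HB n Q,
      ‖OI (a ⊔ (a - sc Q h.1)) (b ⊓ (b - sc Q h.1)) (dl (sc Q h.1) q)‖ := by
  classical
  have hQ0 : (0 : ℝ) < Q := by exact_mod_cast hQ
  let U := Fin n → Fin Q
  let z : U → (Fin n → ℤ) := fun u j => ((u j : ℕ) : ℤ)
  let su : U → (Fin n → ℝ) := fun u => sc Q (z u)
  let F := FF a b q
  let G : (Fin n → ℝ) → ℂ := fun x => ∑ u : U, F (x + su u)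
  let E : Set (Fin n → ℝ) := Set.Icc (fun _ => -2) (fun _ => 1)
  have hsu : ∀ u j, 0 ≤ su u j ∧ su u j ≤ 1 := by
    intro u j
    simp only [su, sc, z]
    have h1 : ((u j : ℕ) : ℝ) ≤ Q := by exact_mod_cast (u j).2.le
    refine ⟨by positivity, ?_⟩
    rw [div_le_one hQ0]; exact_mod_cast h1
  have hFi : ∀ u, Integrable fun x => F (x + su u) := fun u => (FF_integrable a b q).comp_add_right _
  have hGi : Integrable G := integrable_finsetSum _ fun u _ => hFi u
  have hGint : ∫ x, G x = (Q : ℂ) ^ n * OI a b q := by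
    simp only [G]
    rw [integral_finsetSum _ fun u _ => hFi u]
    have : ∀ u : U, ∫ x, F (x + su u) = OI a b q := by
      intro u
      rw [integral_add_right_eq_self F (su u), FF_integral]
    simp_rw [this]
    rw [Finset.sum_const, Finset.card_univ, nsmul_eq_mul]
    simp [U]
  have hGE : ∀ x, x ∉ E → G x = 0 := by
    intro x hx
    refine Finset.sum_eq_zero fun u _ => ?_
    refine Set.indicator_of_notMem ?_ _
    intro hmem
    apply hx
    refine ⟨fun j => ?_, fun j => ?_⟩
    · have h1 := hmem.1 j
      have h2 := ha j
      have h3 := (hsu u j).2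
      simp only [Pi.add_apply] at h1
      linarith
    · have h1 := hmem.2 j
      have h2 := hb j
      have h3 := (hsu u j).1
      simp only [Pi.add_apply] at h1
      linarith
  have hG2 : ∀ x, ((‖G x‖ ^ 2 : ℝ) : ℂ) =
      ∑ u : U, ∑ v : U, F (x + su u) * (starRingEnd ℂ) (F (x + su v)) := by
    intro x
    have h1 : ((‖G x‖ ^ 2 : ℝ) : ℂ) = G x * (starRingEnd ℂ) (G x) := by
      rw [RCLike.mul_conj]; push_cast; rfl
    rw [h1]
    simp only [G]
    rw [map_sum, Finset.sum_mul_sum]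
  have hprod : ∀ u v : U, Integrable fun x => F (x + su u) * (starRingEnd ℂ) (F (x + su v)) :=
    fun u v => FF_prod_integrable a b _ _ q
  have hG2i : Integrable fun x => ((‖G x‖ ^ 2 : ℝ) : ℂ) := by
    simp_rw [hG2]
    exact integrable_finsetSum _ fun u _ => integrable_finsetSum _ fun v _ => hprod u v
  have hG2r : Integrable fun x => ‖G x‖ ^ 2 := by
    have h5 := hG2i.re
    refine h5.congr (Eventually.of_forall fun x => ?_)
    exact Complex.ofReal_re _
  have hvol : (volume : Measure (Fin n → ℝ)).real E = 3 ^ n := by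
    simp only [E]
    rw [Measure.real, Real.volume_Icc_pi]
    simp only [Finset.prod_const, Finset.card_univ, Fintype.card_fin]
    rw [ENNReal.toReal_pow, ENNReal.toReal_ofReal (by norm_num)]
    norm_num
  have hE : (volume : Measure (Fin n → ℝ)) E ≠ ⊤ := isCompact_Icc.measure_lt_top.ne
  have hcs := cs_set E hE G hGi.integrableOn hG2r.integrableOn
  rw [setIntegral_eq_integral_of_forall_compl_eq_zero hGE, hGint, hvol,
    setIntegral_eq_integral_of_forall_compl_eq_zero
      (fun x hx => by rw [hGE x hx]; simp)] at hcs
  let g : (Fin n → ℤ) → ℝ := fun h =>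
    ‖OI (a ⊔ (a - sc Q h)) (b ⊓ (b - sc Q h)) (dl (sc Q h) q)‖
  have hcorr : ∀ u v : U, ‖∫ x, F (x + su u) * (starRingEnd ℂ) (F (x + su v))‖ =
      g (z u - z v) := by
    intro u v
    have h1 : ∀ x, F (x + su u) * (starRingEnd ℂ) (F (x + su v)) =
        (fun y => F (y + (su u - su v)) * (starRingEnd ℂ) (F y)) (x + su v) := by
      intro x
      simp only
      congr 2
      abel
    simp_rw [h1]
    rw [integral_add_right_eq_self (fun y => F (y + (su u - su v)) * (starRingEnd ℂ) (F y)) (su v),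
      FF_corr]
    have h2 : su u - su v = sc Q (z u - z v) := by
      funext j
      simp only [su, sc, Pi.sub_apply]
      push_cast
      ring
    rw [h2]
  have hle : ∫ x, ‖G x‖ ^ 2 ≤ ∑ u : U, ∑ v : U, g (z u - z v) := by
    have h1 : ∫ x, ‖G x‖ ^ 2 ≤ ‖∫ x, ((‖G x‖ ^ 2 : ℝ) : ℂ)‖ := by
      rw [integral_complex_ofReal, Complex.norm_real]
      exact Real.le_norm_self _
    refine h1.trans ?_
    simp_rw [hG2]
    rw [integral_finsetSum _ fun u _ => integrable_finsetSum _ fun v _ => hprod u v]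
    refine (norm_sum_le _ _).trans (Finset.sum_le_sum fun u _ => ?_)
    rw [integral_finsetSum _ fun v _ => hprod u v]
    refine (norm_sum_le _ _).trans (Finset.sum_le_sum fun v _ => ?_)
    rw [hcorr]
  have hgn : ∀ h, 0 ≤ g h := fun h => norm_nonneg _
  have hsum : ∀ u : U, ∑ v : U, g (z u - z v) ≤ ∑ h : HB n Q, g h.1 := by
    intro u
    let ψ : U → HB n Q := fun v => ⟨z u - z v, by
      rw [Fintype.mem_piFinset]
      intro j
      rw [Finset.mem_Icc]
      have h1 := (u j).2
      have h2 := (v j).2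
      simp only [z, Pi.sub_apply]
      constructor <;> omega⟩
    have hψ : Function.Injective ψ := by
      intro v v' hvv
      have h1 : z u - z v = z u - z v' := congrArg Subtype.val hvv
      funext j
      have h2 := congrFun h1 j
      simp only [z, Pi.sub_apply] at h2
      exact Fin.ext (by omega)
    calc ∑ v : U, g (z u - z v) = ∑ v : U, g (ψ v).1 := rfl
      _ = ∑ h ∈ Finset.univ.image ψ, g h.1 := by
        rw [Finset.sum_image (fun _ _ _ _ h => hψ h)]
      _ ≤ _ := Finset.sum_le_sum_of_subset_of_nonneg (Finset.subset_univ _) fun _ _ _ => hgn _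
  have htot : ∫ x, ‖G x‖ ^ 2 ≤ (Q : ℝ) ^ n * ∑ h : HB n Q, g h.1 := by
    refine hle.trans ((Finset.sum_le_sum fun u _ => hsum u).trans ?_)
    rw [Finset.sum_const, Finset.card_univ, nsmul_eq_mul]
    simp [U]
  have hQn : 0 < (Q : ℝ) ^ n := by positivity
  have hfin : ((Q : ℝ) ^ n) ^ 2 * ‖OI a b q‖ ^ 2 ≤ 3 ^ n * ((Q : ℝ) ^ n * ∑ h : HB n Q, g h.1) := by
    have h1 : ‖(Q : ℂ) ^ n * OI a b q‖ = (Q : ℝ) ^ n * ‖OI a b q‖ := by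
      rw [norm_mul, norm_pow]; simp
    rw [h1, mul_pow] at hcs
    exact hcs.trans (mul_le_mul_of_nonneg_left htot (by positivity))
  have h9 : ‖OI a b q‖ ^ 2 ≤ (3 ^ n * ((Q : ℝ) ^ n * ∑ h : HB n Q, g h.1)) / ((Q : ℝ) ^ n) ^ 2 := by
    rw [le_div_iff₀ (by positivity)]; linarith
  refine h9.trans (le_of_eq ?_)
  simp only [g]
  field_simp

end VanDerCorput

section Weyl
variable {n : ℕ}

def kerW (Q m : ℕ) (q : MvPolynomial (Fin n) ℝ) (hs : Fin m → HB n Q) : ℝ :=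
  ∏ j, (max 1 |MM m (fun i => sc Q (hs i).1) (pderiv j q)|)⁻¹

lemma weyl (n m : ℕ) : ∃ c : ℝ, 0 < c ∧ ∀ Q : ℕ, 1 ≤ Q → ∀ a b : Fin n → ℝ,
    (∀ j, -1 ≤ a j) → (∀ j, b j ≤ 1) → (∀ j, b j - a j ≤ 1) →
    ∀ q : MvPolynomial (Fin n) ℝ, q ∈ LTd ℝ n (m + 2) →
    ‖OI a b q‖ ^ (2 ^ m) ≤ c * (((Q : ℝ) ^ n) ^ m)⁻¹ * ∑ hs : Fin m → HB n Q, kerW Q m q hs := by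
  induction m with
  | zero =>
    refine ⟨1, one_pos, fun Q hQ a b ha hb hab q hq => ?_⟩
    have h1 := osc_lin a b hab q hq
    simp only [pow_zero, pow_one, inv_one, mul_one, one_mul, kerW, MM]
    rw [Fintype.sum_unique]
    exact h1
  | succ m ih =>
    obtain ⟨c, hc0, hc⟩ := ih
    refine ⟨(3 ^ n) ^ (2 ^ m) * (3 ^ n) ^ (2 ^ m - 1) * c, by positivity, ?_⟩
    intro Q hQ a b ha hb hab q hq
    have hQ0 : (0 : ℝ) < Q := by exact_mod_cast hQ
    set T : ℝ := (Q : ℝ) ^ n with hT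
    have hT0 : 0 < T := by positivity
    let g : HB n Q → ℝ := fun h =>
      ‖OI (a ⊔ (a - sc Q h.1)) (b ⊓ (b - sc Q h.1)) (dl (sc Q h.1) q)‖
    have hg0 : ∀ h, 0 ≤ g h := fun h => norm_nonneg _
    have hv := vdC Q hQ a b ha hb q
    have hgb : ∀ h, g h ^ (2 ^ m) ≤ c * (T ^ m)⁻¹ *
        ∑ hs : Fin m → HB n Q, kerW Q (m + 1) q (Fin.cons h hs) := by
      intro h
      have h1 := hc Q hQ (a ⊔ (a - sc Q h.1)) (b ⊓ (b - sc Q h.1))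
        (fun j => (ha j).trans le_sup_left) (fun j => (inf_le_left).trans (hb j))
        (fun j => by
          have h1 : a j ≤ (a ⊔ (a - sc Q h.1)) j := le_sup_left
          have h2 : (b ⊓ (b - sc Q h.1)) j ≤ b j := inf_le_left
          have := hab j
          linarith) (dl (sc Q h.1) q) (dl_mem _ (m + 2) q hq).1
      refine h1.trans (le_of_eq ?_)
      congr 1
      refine Finset.sum_congr rfl fun hs _ => ?_
      unfold kerW
      refine Finset.prod_congr rfl fun j _ => ?_
      rw [MM_dl m _ _ q hq]
      have hfe : (fun i => sc Q ((Fin.cons h hs : Fin (m + 1) → HB n Q) i).1) =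
          Fin.cons (sc Q h.1) (fun i => sc Q (hs i).1) := by
        funext i
        refine Fin.cases ?_ (fun i => ?_) i <;> simp
      rw [hfe]
    have hpow : (∑ h, g h) ^ (2 ^ m) ≤ ((3 : ℝ) ^ n * T) ^ (2 ^ m - 1) * ∑ h, g h ^ (2 ^ m) := by
      have h2 : 2 ^ m = (2 ^ m - 1) + 1 := (Nat.sub_add_cancel Nat.one_le_two_pow).symm
      have h3 := pow_sum_div_card_le_sum_pow (s := (Finset.univ : Finset (HB n Q))) (f := g)
        (fun h _ => hg0 h) (2 ^ m - 1)
      rw [← h2] at h3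
      have hcard : ((Finset.univ : Finset (HB n Q)).card : ℝ) ≤ 3 ^ n * T := by
        rw [Finset.card_univ, HB_card, hT, ← mul_pow]
        push_cast
        refine pow_le_pow_left₀ (by positivity) ?_ n
        have : (1 : ℝ) ≤ Q := by exact_mod_cast hQ
        linarith
      have hcard0 : (0 : ℝ) < ((Finset.univ : Finset (HB n Q)).card : ℝ) := by
        rw [Finset.card_univ, HB_card]
        have : (0:ℕ) < (2 * Q + 1) ^ n := pow_pos (Nat.succ_pos _) n
        exact_mod_cast this
      rw [div_le_iff₀ (pow_pos hcard0 _)] at h3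
      refine h3.trans ?_
      rw [mul_comm]
      refine mul_le_mul_of_nonneg_right ?_ (Finset.sum_nonneg fun h _ => by positivity)
      exact pow_le_pow_left₀ hcard0.le hcard _
    have hsum : ∑ hs : Fin (m + 1) → HB n Q, kerW Q (m + 1) q hs =
        ∑ h : HB n Q, ∑ hs : Fin m → HB n Q, kerW Q (m + 1) q (Fin.cons h hs) := by
      rw [← Fintype.sum_prod_type']
      exact (Fintype.sum_equiv (Fin.consEquiv fun _ => HB n Q) _ _ fun x => rfl).symm
    calc ‖OI a b q‖ ^ (2 ^ (m + 1)) = (‖OI a b q‖ ^ 2) ^ (2 ^ m) := by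
          rw [← pow_mul, pow_succ]; ring_nf
      _ ≤ (3 ^ n * T⁻¹ * ∑ h, g h) ^ (2 ^ m) := pow_le_pow_left₀ (by positivity) hv _
      _ = (3 ^ n) ^ (2 ^ m) * (T⁻¹) ^ (2 ^ m) * (∑ h, g h) ^ (2 ^ m) := by rw [mul_pow, mul_pow]
      _ ≤ (3 ^ n) ^ (2 ^ m) * (T⁻¹) ^ (2 ^ m) *
          (((3 : ℝ) ^ n * T) ^ (2 ^ m - 1) * ∑ h, (c * (T ^ m)⁻¹ *
            ∑ hs : Fin m → HB n Q, kerW Q (m + 1) q (Fin.cons h hs))) := by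
          refine mul_le_mul_of_nonneg_left (hpow.trans ?_) (by positivity)
          exact mul_le_mul_of_nonneg_left (Finset.sum_le_sum fun h _ => hgb h) (by positivity)
      _ = _ := by
          rw [hsum, ← Finset.mul_sum, mul_pow, pow_succ T m]
          have h5 : (T⁻¹) ^ (2 ^ m) * T ^ (2 ^ m - 1) = T⁻¹ := by
            have h2 : 2 ^ m = (2 ^ m - 1) + 1 := (Nat.sub_add_cancel Nat.one_le_two_pow).symm
            conv_lhs => rw [h2]
            rw [pow_succ, Nat.add_sub_cancel, inv_pow]
            field_simp
          rw [mul_inv]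
          calc _ = (3 ^ n) ^ (2 ^ m) * (3 ^ n) ^ (2 ^ m - 1) * c * ((T ^ m)⁻¹ *
              ((T⁻¹) ^ (2 ^ m) * T ^ (2 ^ m - 1))) *
              ∑ h : HB n Q, ∑ hs : Fin m → HB n Q, kerW Q (m + 1) q (Fin.cons h hs) := by ring
            _ = _ := by rw [h5]

end Weyl

section Group
variable {n : ℕ}

def wr (r : ℤ) : ℝ := 3 / (1 + |(r : ℝ)|)

lemma wr_nonneg (r : ℤ) : 0 ≤ wr r := by unfold wr; positivity

lemma ker_le_wr (x : ℝ) : (max 1 |x|)⁻¹ ≤ wr ⌊x⌋ := by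
  unfold wr
  have h1 : (0 : ℝ) < max 1 |x| := lt_of_lt_of_le one_pos (le_max_left _ _)
  rw [inv_eq_one_div, div_le_div_iff₀ h1 (by positivity), one_mul]
  have h2 := Int.floor_le x
  have h3 := Int.lt_floor_add_one x
  have h4 := le_max_left 1 |x|
  have h5 := le_max_right 1 |x|
  have h6 : |(⌊x⌋ : ℝ)| ≤ |x| + 1 := by
    rw [abs_le]
    have := le_abs_self x
    have := neg_abs_le x
    constructor <;> linarith
  linarith

lemma wr_sum_le (L : ℕ) : ∑ r ∈ Finset.Icc (-(L : ℤ)) L, wr r ≤ 6 * (1 + Real.log (L + 1)) := by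
  have h1 : ∑ r ∈ Finset.Icc (-(L : ℤ)) L, wr r ≤
      ∑ k ∈ Finset.range (L + 1), (wr (k : ℤ) + wr (-(k : ℤ))) := by
    rw [Finset.sum_add_distrib]
    have hsub : Finset.Icc (-(L : ℤ)) L ⊆
        ((Finset.range (L + 1)).image fun k : ℕ => (k : ℤ)) ∪
          ((Finset.range (L + 1)).image fun k : ℕ => -(k : ℤ)) := by
      intro r hr
      rw [Finset.mem_Icc] at hr
      rw [Finset.mem_union, Finset.mem_image, Finset.mem_image]
      rcases le_total 0 r with h | h
      · left; exact ⟨r.toNat, by rw [Finset.mem_range]; omega, by omega⟩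
      · right; exact ⟨(-r).toNat, by rw [Finset.mem_range]; omega, by omega⟩
    refine (Finset.sum_le_sum_of_subset_of_nonneg hsub fun r _ _ => wr_nonneg r).trans ?_
    have h2 := Finset.sum_union_inter (s₁ := (Finset.range (L + 1)).image fun k : ℕ => (k : ℤ))
      (s₂ := (Finset.range (L + 1)).image fun k : ℕ => -(k : ℤ)) (f := wr)
    rw [Finset.sum_image (f := wr) (g := fun k : ℕ => (k : ℤ)) (by intro a _ b _ h; simpa using h),
      Finset.sum_image (f := wr) (g := fun k : ℕ => -(k : ℤ)) (by intro a _ b _ h; simpa using h)] at h2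
    have h3 : 0 ≤ ∑ r ∈ ((Finset.range (L + 1)).image fun k : ℕ => (k : ℤ)) ∩
          ((Finset.range (L + 1)).image fun k : ℕ => -(k : ℤ)), wr r :=
      Finset.sum_nonneg fun r _ => wr_nonneg r
    linarith
  refine h1.trans ?_
  have h2 : ∀ k : ℕ, wr (k : ℤ) + wr (-(k : ℤ)) = 6 * ((k : ℝ) + 1)⁻¹ := by
    intro k
    unfold wr
    push_cast
    rw [abs_neg, abs_of_nonneg (by positivity : (0 : ℝ) ≤ k)]
    field_simp
    ring
  simp_rw [h2]
  rw [← Finset.mul_sum]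
  refine mul_le_mul_of_nonneg_left ?_ (by norm_num)
  have h3 := harmonic_le_one_add_log (L + 1)
  unfold harmonic at h3
  push_cast at h3
  exact h3

lemma wr_pow (n : ℕ) (hn : 1 ≤ n) : ∃ c : ℝ, 0 < c ∧ ∀ Q : ℕ, 1 ≤ Q →
    (∑ r ∈ Finset.Icc (-((Q ^ n : ℕ) : ℤ)) ((Q ^ n : ℕ) : ℤ), wr r) ^ n ≤ c * Q := by
  refine ⟨(6 * (1 + n * (n * 2))) ^ n, by positivity, fun Q hQ => ?_⟩
  have hn0 : (0 : ℝ) < n := by exact_mod_cast hn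
  have hQ1 : (1 : ℝ) ≤ Q := by exact_mod_cast hQ
  have h0 := wr_sum_le (Q ^ n)
  have hx : (1 : ℝ) ≤ (Q : ℝ) ^ ((n : ℝ)⁻¹) := Real.one_le_rpow hQ1 (by positivity)
  have h1 : Real.log (((Q ^ n : ℕ) : ℝ) + 1) ≤ n * (n * 2) * (Q : ℝ) ^ ((n : ℝ)⁻¹) := by
    have h2 : ((Q ^ n : ℕ) : ℝ) + 1 ≤ (2 * Q : ℝ) ^ n := by
      push_cast
      rw [mul_pow]
      have h3 : (1 : ℝ) ≤ (Q : ℝ) ^ n := one_le_pow₀ hQ1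
      have h4 : (2 : ℝ) ≤ 2 ^ n := by
        calc (2 : ℝ) = 2 ^ 1 := by norm_num
          _ ≤ 2 ^ n := pow_le_pow_right₀ (by norm_num) hn
      nlinarith
    have h3 : Real.log (((Q ^ n : ℕ) : ℝ) + 1) ≤ Real.log ((2 * Q : ℝ) ^ n) :=
      Real.log_le_log (by positivity) h2
    rw [Real.log_pow] at h3
    have h4 : Real.log (2 * Q) ≤ (2 * Q : ℝ) ^ ((n : ℝ)⁻¹) / (n : ℝ)⁻¹ :=
      Real.log_le_rpow_div (by positivity) (by positivity)
    have h5 : (2 * Q : ℝ) ^ ((n : ℝ)⁻¹) ≤ 2 * (Q : ℝ) ^ ((n : ℝ)⁻¹) := by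
      rw [Real.mul_rpow (by norm_num) (by positivity)]
      refine mul_le_mul_of_nonneg_right ?_ (by positivity)
      have : (2 : ℝ) ^ ((n : ℝ)⁻¹) ≤ 2 ^ (1 : ℝ) :=
        Real.rpow_le_rpow_of_exponent_le (by norm_num)
          (inv_le_one_of_one_le₀ (by exact_mod_cast hn))
      simpa using this
    refine h3.trans ?_
    rw [div_inv_eq_mul] at h4
    calc (n : ℝ) * Real.log (2 * Q) ≤ n * ((2 * Q : ℝ) ^ ((n : ℝ)⁻¹) * n) :=
          mul_le_mul_of_nonneg_left h4 hn0.le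
      _ ≤ n * ((2 * (Q : ℝ) ^ ((n : ℝ)⁻¹)) * n) := by gcongr
      _ = _ := by ring
  have h6 : (∑ r ∈ Finset.Icc (-((Q ^ n : ℕ) : ℤ)) ((Q ^ n : ℕ) : ℤ), wr r) ≤
      6 * (1 + n * (n * 2)) * (Q : ℝ) ^ ((n : ℝ)⁻¹) := by
    refine h0.trans ?_
    nlinarith
  refine (pow_le_pow_left₀ (Finset.sum_nonneg fun r _ => wr_nonneg r) h6 n).trans ?_
  rw [mul_pow, Real.rpow_inv_natCast_pow (by positivity) (by omega)]

lemma group_sum {H : Type} [Fintype H] (f : H → Fin n → ℝ) (L : ℕ) (hL : 1 ≤ L) (N : ℝ)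
    (hN : ∀ r : Fin n → ℤ,
      ((Finset.univ.filter fun h => (fun j => ⌊f h j⌋) = r).card : ℝ) ≤ N) :
    ∑ h, ∏ j, (max 1 |f h j|)⁻¹ ≤ Fintype.card H * (L : ℝ)⁻¹ +
      N * (∑ r ∈ Finset.Icc (-(L : ℤ)) L, wr r) ^ n := by
  classical
  have hL0 : (0 : ℝ) < L := by exact_mod_cast hL
  set P := Fintype.piFinset fun _ : Fin n => Finset.Icc (-(L : ℤ)) L with hP
  have hpt : ∀ h, ∏ j, (max 1 |f h j|)⁻¹ ≤ (L : ℝ)⁻¹ +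
      ∑ r ∈ P, if (fun j => ⌊f h j⌋) = r then ∏ j, wr (r j) else 0 := by
    intro h
    rw [Finset.sum_ite_eq]
    have hk : ∀ j, (max 1 |f h j|)⁻¹ ≤ 1 := fun j => inv_le_one_of_one_le₀ (le_max_left _ _)
    have hk0 : ∀ j, 0 ≤ (max 1 |f h j|)⁻¹ := fun j =>
      inv_nonneg.2 (zero_le_one.trans (le_max_left _ _))
    split_ifs with hm
    · have : ∏ j, (max 1 |f h j|)⁻¹ ≤ ∏ j, wr ⌊f h j⌋ :=
        Finset.prod_le_prod (fun j _ => hk0 j) fun j _ => ker_le_wr _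
      have : 0 < (L : ℝ)⁻¹ := by positivity
      linarith
    · rw [add_zero]
      rw [hP, Fintype.mem_piFinset] at hm
      push Not at hm
      obtain ⟨j, hj⟩ := hm
      have h1 : (L : ℝ) ≤ |f h j| := by
        rw [Finset.mem_Icc, not_and_or, not_le, not_le] at hj
        have h2 := Int.floor_le (f h j)
        have h3 := Int.lt_floor_add_one (f h j)
        rcases hj with hj | hj
        · have : ((⌊f h j⌋ : ℤ) : ℝ) + 1 ≤ -(L : ℝ) := by exact_mod_cast hj
          have := neg_abs_le (f h j)
          linarith
        · have : (L : ℝ) < ((⌊f h j⌋ : ℤ) : ℝ) := by exact_mod_cast hj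
          have := le_abs_self (f h j)
          linarith
      rw [← Finset.mul_prod_erase _ _ (Finset.mem_univ j)]
      have h4 : ∏ x ∈ Finset.univ.erase j, (max 1 |f h x|)⁻¹ ≤ 1 :=
        Finset.prod_le_one (fun j _ => hk0 j) fun j _ => hk j
      have h5 : (max 1 |f h j|)⁻¹ ≤ (L : ℝ)⁻¹ :=
        inv_anti₀ hL0 (h1.trans (le_max_right _ _))
      calc _ ≤ (max 1 |f h j|)⁻¹ * 1 := mul_le_mul_of_nonneg_left h4 (hk0 j)
        _ ≤ _ := by rw [mul_one]; exact h5
  refine (Finset.sum_le_sum fun h _ => hpt h).trans ?_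
  rw [Finset.sum_add_distrib]
  refine add_le_add (by simp) ?_
  rw [Finset.sum_comm]
  have h6 : (∑ r ∈ Finset.Icc (-(L : ℤ)) L, wr r) ^ n = ∑ r ∈ P, ∏ j, wr (r j) := by
    have := Finset.prod_univ_sum (fun _ : Fin n => Finset.Icc (-(L : ℤ)) L) (fun _ r => wr r)
    rw [← this]; simp
  rw [h6, Finset.mul_sum]
  refine Finset.sum_le_sum fun r _ => ?_
  rw [← Finset.sum_filter, Finset.sum_const, nsmul_eq_mul]
  exact mul_le_mul_of_nonneg_right (hN r) (Finset.prod_nonneg fun j _ => wr_nonneg _)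

end Group

section Weyl2

lemma weyl2 (n e : ℕ) (hn : 1 ≤ n) : ∃ c : ℝ, 0 < c ∧ ∀ Q : ℕ, 1 ≤ Q → ∀ a b : Fin n → ℝ,
    (∀ j, -1 ≤ a j) → (∀ j, b j ≤ 1) → (∀ j, b j - a j ≤ 1) →
    ∀ q : MvPolynomial (Fin n) ℝ, q ∈ LTd ℝ n (e + 3) → ∀ N : ℝ,
    (∀ S : Finset (Fin (e + 1) → Fin n → ℤ), (∀ h ∈ S, ∀ i j, |h i j| ≤ 2 * (Q : ℤ)) →
      (∀ h ∈ S, ∀ j, |MM (e + 1) (fun i => sc Q (h i)) (pderiv j q)| ≤ 1) → (S.card : ℝ) ≤ N) →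
    ‖OI a b q‖ ^ (2 ^ (e + 1)) ≤
      c * (((Q : ℝ) ^ n) ^ (e + 1))⁻¹ * (N * Q + (Q : ℝ) ^ (n * e)) := by
  classical
  obtain ⟨c1, hc1, hw⟩ := weyl n (e + 1)
  obtain ⟨c2, hc2, hr⟩ := wr_pow n hn
  refine ⟨c1 * (c2 + 3 ^ (n * (e + 1))), by positivity, ?_⟩
  intro Q hQ a b ha hb hab q hq N hN
  have hQ1 : (1 : ℝ) ≤ Q := by exact_mod_cast hQ
  have h1 := hw Q hQ a b ha hb hab q hq
  refine h1.trans ?_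
  have hsum : ∑ hs : Fin (e + 1) → HB n Q, kerW Q (e + 1) q hs =
      ∑ t : Fin e → HB n Q, ∑ h : HB n Q, kerW Q (e + 1) q (Fin.cons h t) := by
    rw [Finset.sum_comm, ← Fintype.sum_prod_type']
    exact (Fintype.sum_equiv (Fin.consEquiv fun _ => HB n Q) _ _ fun x => rfl).symm
  let Box : Finset (Fin (e + 1) → Fin n → ℤ) := Fintype.piFinset fun _ =>
    Fintype.piFinset fun _ => Finset.Icc (-(2 * (Q : ℤ))) (2 * (Q : ℤ))
  let S : Finset (Fin (e + 1) → Fin n → ℤ) :=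
    Box.filter fun h => ∀ j, |MM (e + 1) (fun i => sc Q (h i)) (pderiv j q)| ≤ 1
  have memBox : ∀ h, h ∈ Box ↔ ∀ i j, |h i j| ≤ 2 * (Q : ℤ) := by
    intro h
    simp only [Box, Fintype.mem_piFinset, Finset.mem_Icc, abs_le]
  have hSN : (S.card : ℝ) ≤ N := by
    refine hN S (fun h hh => ?_) (fun h hh => (Finset.mem_filter.1 hh).2)
    exact (memBox h).1 (Finset.mem_filter.1 hh).1
  let F : (Fin e → HB n Q) → Finset (Fin (e + 1) → Fin n → ℤ) := fun t =>
    S.filter fun s => Fin.tail s = fun i => (t i).1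
  have hF : ∑ t, ((F t).card : ℝ) ≤ S.card := by
    rw [← Nat.cast_sum, ← Finset.card_biUnion]
    · refine Nat.cast_le.2 (Finset.card_le_card ?_)
      intro s hs
      obtain ⟨t, _, ht⟩ := Finset.mem_biUnion.1 hs
      exact (Finset.mem_filter.1 ht).1
    · intro t _ t' _ htt
      rw [Function.onFun, Finset.disjoint_left]
      intro s hs hs'
      apply htt
      funext i
      apply Subtype.ext
      have h1 := (Finset.mem_filter.1 hs).2
      have h2 := (Finset.mem_filter.1 hs').2
      exact congrFun (h1.symm.trans h2) i
  have hsc : ∀ (h : Fin n → ℤ) (t : Fin e → Fin n → ℤ),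
      (fun i => sc Q ((Fin.cons h t : Fin (e + 1) → Fin n → ℤ) i)) =
        Fin.cons (sc Q h) (fun i => sc Q (t i)) := by
    intro h t
    funext i
    refine Fin.cases ?_ (fun i => ?_) i <;> simp
  have hsc' : ∀ (h : HB n Q) (t : Fin e → HB n Q),
      (fun i => sc Q ((Fin.cons h t : Fin (e + 1) → HB n Q) i).1) =
        Fin.cons (sc Q h.1) (fun i => sc Q (t i).1) := by
    intro h t
    funext i
    refine Fin.cases ?_ (fun i => ?_) i <;> simp
  have hHB : ∀ (h : HB n Q) j, |h.1 j| ≤ (Q : ℤ) := by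
    intro h j
    have := Fintype.mem_piFinset.1 h.2 j
    rw [Finset.mem_Icc] at this
    exact abs_le.2 this
  have hin : ∀ t, ∑ h : HB n Q, kerW Q (e + 1) q (Fin.cons h t) ≤
      (Fintype.card (HB n Q) : ℝ) * ((Q ^ n : ℕ) : ℝ)⁻¹ + (F t).card * (c2 * Q) := by
    intro t
    have hg := group_sum (n := n) (H := HB n Q)
      (fun h j => MM (e + 1) (fun i => sc Q ((Fin.cons h t : Fin (e + 1) → HB n Q) i).1) (pderiv j q))
      (Q ^ n) (Nat.one_le_pow _ _ hQ) ((F t).card : ℝ) (by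
        intro r
        refine Nat.cast_le.2 ?_
        set A := Finset.univ.filter fun h : HB n Q => (fun j => ⌊MM (e + 1)
          (fun i => sc Q ((Fin.cons h t : Fin (e + 1) → HB n Q) i).1) (pderiv j q)⌋) = r with hA
        rcases A.eq_empty_or_nonempty with h0 | ⟨h0, hh0⟩
        · rw [h0]; simp
        refine Finset.card_le_card_of_injOn
          (fun h => Fin.cons (h.1 - h0.1) (fun i => (t i).1)) ?_ ?_
        · intro h hh
          have hhA := (Finset.mem_filter.1 hh).2
          have hhA0 := (Finset.mem_filter.1 hh0).2
          refine Finset.mem_coe.2 (Finset.mem_filter.2 ⟨Finset.mem_filter.2 ⟨?_, ?_⟩, ?_⟩)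
          · rw [memBox]
            intro i j
            refine Fin.cases ?_ (fun i => ?_) i
            · simp only [Fin.cons_zero, Pi.sub_apply]
              have h1 := hHB h j
              have h2 := hHB h0 j
              rw [abs_le] at h1 h2 ⊢
              constructor <;> linarith [h1.1, h1.2, h2.1, h2.2]
            · simp only [Fin.cons_succ]
              have h1 := hHB (t i) j
              have : (0 : ℤ) ≤ Q := by positivity
              linarith
          · intro j
            rw [hsc]
            have hs : sc Q (h.1 - h0.1) = sc Q h.1 - sc Q h0.1 := by
              funext j; simp [sc, sub_div]
            rw [hs, MM_cons_sub]
            have h1 := congrFun (hhA.trans hhA0.symm) j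
            simp only [hsc'] at h1
            exact (Int.abs_sub_lt_one_of_floor_eq_floor h1).le
          · funext i; simp [Fin.tail]
        · intro h _ h' _ hhh
          have h1 := congrFun hhh 0
          simp only [Fin.cons_zero] at h1
          exact Subtype.ext (sub_left_injective h1))
    refine hg.trans ?_
    refine add_le_add le_rfl (mul_le_mul_of_nonneg_left (hr Q hQ) (by positivity))
  rw [hsum]
  have htot : ∑ t : Fin e → HB n Q, ∑ h : HB n Q, kerW Q (e + 1) q (Fin.cons h t) ≤
      (c2 + 3 ^ (n * (e + 1))) * (N * Q + (Q : ℝ) ^ (n * e)) := by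
    refine (Finset.sum_le_sum fun t _ => hin t).trans ?_
    rw [Finset.sum_add_distrib, Finset.sum_const, Finset.card_univ, Fintype.card_fun,
      Fintype.card_fin, ← Finset.sum_mul, nsmul_eq_mul, HB_card]
    have hN0 : 0 ≤ N := le_trans (by positivity) hSN
    have e1 : (∑ t, ((F t).card : ℝ)) * (c2 * Q) ≤ N * (c2 * Q) :=
      mul_le_mul_of_nonneg_right (hF.trans hSN) (by positivity)
    have e2 : ((((2 * Q + 1) ^ n) ^ e : ℕ) : ℝ) * ((((2 * Q + 1) ^ n : ℕ) : ℝ) *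
        ((Q ^ n : ℕ) : ℝ)⁻¹) ≤ 3 ^ (n * (e + 1)) * (Q : ℝ) ^ (n * e) := by
      push_cast
      rw [← mul_assoc, ← div_eq_mul_inv, div_le_iff₀ (by positivity), ← pow_succ, ← pow_mul]
      calc (2 * (Q : ℝ) + 1) ^ (n * (e + 1)) ≤ (3 * Q) ^ (n * (e + 1)) :=
            pow_le_pow_left₀ (by positivity) (by linarith) _
        _ = _ := by rw [mul_pow, mul_add, mul_one]; ring
    have e3 : 0 ≤ N * Q := by positivity
    have e4 : (0 : ℝ) ≤ (Q : ℝ) ^ (n * e) := by positivity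
    have e5 : (0 : ℝ) < 3 ^ (n * (e + 1)) := by positivity
    nlinarith [mul_nonneg e5.le e3, mul_nonneg hc2.le e4]
  calc _ ≤ c1 * (((Q : ℝ) ^ n) ^ (e + 1))⁻¹ *
        ((c2 + 3 ^ (n * (e + 1))) * (N * Q + (Q : ℝ) ^ (n * e))) :=
        mul_le_mul_of_nonneg_left htot (by positivity)
    _ = _ := by ring

end Weyl2

section Decay

def qq {n R : ℕ} (g : Fin R → MvPolynomial (Fin n) ℤ) (γ : Fin R → ℝ) : MvPolynomial (Fin n) ℝ :=
  ∑ i, γ i • MvPolynomial.map (Int.castRingHom ℝ) (g i)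

lemma MM_qq {n R : ℕ} (g : Fin R → MvPolynomial (Fin n) ℤ) (γ : Fin R → ℝ) (Q m : ℕ)
    (h : Fin m → Fin n → ℤ) (j : Fin n) :
    MM m (fun i => sc Q (h i)) (pderiv j (qq g γ)) =
      ((Q : ℝ)⁻¹) ^ m * ∑ i, γ i * ((MM m h (pderiv j (g i)) : ℤ) : ℝ) := by
  have h1 : (fun i => sc Q (h i)) = fun i j => (Q : ℝ)⁻¹ * ((h i j : ℤ) : ℝ) := by
    funext i j; simp only [sc]; rw [div_eq_inv_mul]
  rw [h1, MM_smul_arg, qq, map_sum, MM_sum]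
  congr 1
  refine Finset.sum_congr rfl fun i _ => ?_
  rw [Derivation.map_smul, MM_smul, pderiv_map]
  congr 1
  exact (MM_map (Int.castRingHom ℝ) m h (pderiv j (g i))).symm

lemma osc_bound (n R e B : ℕ) (hn : 1 ≤ n) : ∃ c1 c : ℝ, 0 < c1 ∧ 0 < c ∧
    ∀ g : Fin R → MvPolynomial (Fin n) ℤ, (∀ i, (g i).IsHomogeneous (e + 2)) →
    ∀ Ct : ℝ, (∀ i α, |((coeff α (g i) : ℤ) : ℝ)| ≤ Ct) →
    ∀ Δ : ℕ, birchDelta n R g ≤ ((Δ : ℕ∞) : WithBot ℕ∞) → Δ + 2 ^ (e + 1) * B + 1 ≤ n →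
    ∀ a b : Fin n → ℝ, (∀ j, -1 ≤ a j) → (∀ j, b j ≤ 1) → (∀ j, b j - a j ≤ 1) →
    ∀ (Q : ℕ) (γ : Fin R → ℝ), 1 ≤ Q →
    (∃ i, c1 * Ct ^ (R - 1) * (Q : ℝ) ^ (R * (e + 1)) < |γ i|) →
    ‖OI a b (qq g γ)‖ ^ (2 ^ (e + 1)) ≤ c * ((Q : ℝ) ^ (2 ^ (e + 1) * B))⁻¹ := by
  obtain ⟨c1, hc1, hA7⟩ := cramer_forms n R e
  obtain ⟨c2, hc2, hW⟩ := weyl2 n e hn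
  choose cc hcc using fun s => count_MM Qbar n e s
  refine ⟨c1, c2 * ((∑ s ∈ Finset.range n, (cc s : ℝ)) + 1), hc1, by positivity, ?_⟩
  intro g hg Ct hCt Δ hΔ hΔn a b ha hb hab Q γ hQ hγ
  have hQ1 : (1 : ℝ) ≤ Q := by exact_mod_cast hQ
  have hQ0 : (0 : ℝ) < Q := by linarith
  have hq : qq g γ ∈ LTd ℝ n (e + 3) := by
    refine Submodule.sum_mem _ fun i _ => Submodule.smul_mem _ _ ?_
    exact LTd_of_hom ((hg i).map _)
  set cs : ℝ := ∑ s ∈ Finset.range n, (cc s : ℝ) with hcs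
  have hle : (cc Δ : ℝ) ≤ cs :=
    Finset.single_le_sum (f := fun s => (cc s : ℝ)) (fun s _ => by positivity)
      (Finset.mem_range.2 (by omega))
  have hN := hW Q hQ a b ha hb hab (qq g γ) hq (cs * (Q : ℝ) ^ (n * e + Δ)) (by
    intro S hS hS1
    obtain ⟨b, hb0, hbS⟩ := hA7 g hg Ct hCt Q hQ γ S hS (by
      intro h hh j
      have h1 := hS1 h hh j
      rw [MM_qq, abs_mul, abs_of_pos (by positivity), inv_pow, inv_mul_le_iff₀ (by positivity),
        mul_one] at h1
      exact h1) hγ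
    have hhom : (∑ i, b i • g i).IsHomogeneous (e + 2) := by
      refine IsHomogeneous.sum _ _ _ fun i _ => ?_
      rw [MvPolynomial.smul_eq_C_mul]
      simpa using (isHomogeneous_C _ (b i)).mul (hg i)
    have hdim := (le_iSup₂ (f := fun (b : Fin R → ℤ) (_ : b ≠ 0) =>
      singDim n (MvPolynomial.map (Int.castRingHom Qbar) (∑ i, b i • g i))) b hb0).trans hΔ
    have h2 := hcc Δ _ hhom hdim Q hQ S hS hbS
    calc (S.card : ℝ) ≤ ((cc Δ * Q ^ (n * e + Δ) : ℕ) : ℝ) := by exact_mod_cast h2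
      _ = cc Δ * (Q : ℝ) ^ (n * e + Δ) := by push_cast; ring
      _ ≤ _ := by gcongr)
  refine hN.trans ?_
  have hcs0 : 0 ≤ cs := le_trans (by positivity) hle
  rw [mul_assoc c2, mul_assoc c2]
  refine mul_le_mul_of_nonneg_left ?_ hc2.le
  rw [inv_mul_le_iff₀ (by positivity), ← pow_mul, mul_left_comm, ← div_eq_mul_inv]
  have h3 : (Q : ℝ) ^ (n * e + Δ + 1) ≤ (Q : ℝ) ^ (n * (e + 1)) / (Q : ℝ) ^ (2 ^ (e + 1) * B) := by
    rw [le_div_iff₀ (by positivity), ← pow_add]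
    refine pow_le_pow_right₀ hQ1 ?_
    rw [mul_add]; omega
  have h4 : (Q : ℝ) ^ (n * e) ≤ (Q : ℝ) ^ (n * e + Δ + 1) := pow_le_pow_right₀ hQ1 (by omega)
  calc cs * (Q : ℝ) ^ (n * e + Δ) * Q + (Q : ℝ) ^ (n * e)
      ≤ cs * (Q : ℝ) ^ (n * e + Δ + 1) + (Q : ℝ) ^ (n * e + Δ + 1) := by
        rw [pow_succ _ (n * e + Δ)] at h4 ⊢; linarith
    _ = (cs + 1) * (Q : ℝ) ^ (n * e + Δ + 1) := by ring
    _ ≤ _ := mul_le_mul_of_nonneg_left h3 (by positivity)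

end Decay

section Decay2

lemma OI_le_one {n : ℕ} (a b : Fin n → ℝ) (hab0 : ∀ j, a j ≤ b j) (hab : ∀ j, b j - a j ≤ 1)
    (q : MvPolynomial (Fin n) ℝ) : ‖OI a b q‖ ≤ 1 := by
  unfold OI
  have h1 := norm_setIntegral_le_of_norm_le_const (μ := (volume : Measure (Fin n → ℝ)))
    (s := Set.Icc a b) (C := 1) (f := fun x => eC (eval x q)) isCompact_Icc.measure_lt_top
    (fun x _ => (norm_eC _).le)
  refine h1.trans ?_
  rw [one_mul, Measure.real, Real.volume_Icc_pi_toReal hab0]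
  exact Finset.prod_le_one (fun j _ => sub_nonneg.2 (hab0 j)) fun j _ => hab j

lemma osc_decay (n R e : ℕ) (hn : 1 ≤ n) (hR : 1 ≤ R) : ∃ c : ℝ, 0 < c ∧
    ∀ g : Fin R → MvPolynomial (Fin n) ℤ, (∀ i, (g i).IsHomogeneous (e + 2)) →
    ∀ Ct : ℝ, 1 ≤ Ct → (∀ i α, |((coeff α (g i) : ℤ) : ℝ)| ≤ Ct) →
    ∀ Δ : ℕ, birchDelta n R g ≤ ((Δ : ℕ∞) : WithBot ℕ∞) →
    Δ + 2 ^ (e + 1) * (R * (e + 1) * (R + 1)) + 1 ≤ n →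
    ∀ a b : Fin n → ℝ, (∀ j, -1 ≤ a j) → (∀ j, b j ≤ 1) → (∀ j, a j ≤ b j) →
    (∀ j, b j - a j ≤ 1) → ∀ γ : Fin R → ℝ,
    ‖OI a b (qq g γ)‖ ≤ c * ((1 + ‖γ‖ / Ct ^ (R - 1)) ^ (R + 1))⁻¹ := by
  obtain ⟨c1, c2, hc1, hc2, H⟩ := osc_bound n R e (R * (e + 1) * (R + 1)) hn
  set M := R * (e + 1) with hM
  have hM1 : 1 ≤ M := Nat.one_le_iff_ne_zero.2 (by positivity)
  set c3 := max c2 1 with hc3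
  have hc31 : 1 ≤ c3 := le_max_right _ _
  refine ⟨c3 * ((1 + 2 * c1) * 2 ^ M) ^ (R + 1), by positivity, ?_⟩
  intro g hg Ct hCt1 hCt Δ hΔ hΔn a b ha hb hab0 hab γ
  set W := Ct ^ (R - 1) with hW
  have hW0 : 0 < W := by positivity
  set x := ‖γ‖ / W with hx
  have hx0 : 0 ≤ x := by positivity
  rw [← div_eq_mul_inv, le_div_iff₀ (by positivity)]
  have h2M : (1 : ℝ) ≤ 2 ^ M := one_le_pow₀ (by norm_num)
  rcases lt_or_ge x (2 * c1) with hlt | hge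
  · have h1 := OI_le_one a b hab0 hab (qq g γ)
    calc _ ≤ 1 * (1 + x) ^ (R + 1) := by gcongr
      _ ≤ c3 * ((1 + 2 * c1) * 2 ^ M) ^ (R + 1) := by
        refine mul_le_mul hc31 (pow_le_pow_left₀ (by positivity) ?_ _) (by positivity)
          (by positivity)
        nlinarith
  · set y := x / (2 * c1) with hy
    have hy1 : 1 ≤ y := (one_le_div₀ (by positivity)).2 hge
    set z := y ^ ((M : ℝ)⁻¹) with hz
    have hz1 : 1 ≤ z := Real.one_le_rpow hy1 (by positivity)
    have hzM : z ^ M = y := Real.rpow_inv_natCast_pow (by positivity) (by omega)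
    set Q := ⌊z⌋₊ with hQ
    have hQ1 : 1 ≤ Q := Nat.le_floor (by simpa using hz1)
    have hQ1' : (1 : ℝ) ≤ Q := by exact_mod_cast hQ1
    have hQz : (Q : ℝ) ≤ z := Nat.floor_le (by positivity)
    have hzQ : z ≤ 2 * Q := by have := Nat.lt_floor_add_one z; linarith
    have hQy : (Q : ℝ) ^ M ≤ y := by rw [← hzM]; gcongr
    have hyQ : y ≤ 2 ^ M * (Q : ℝ) ^ M := by rw [← hzM, ← mul_pow]; gcongr
    have hxy : x = 2 * c1 * y := by rw [hy]; field_simp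
    have hγx : ‖γ‖ = x * W := by rw [hx]; field_simp
    have hex : ∃ i, c1 * W * (Q : ℝ) ^ M < |γ i| := by
      by_contra hcon
      push Not at hcon
      have h1 : ‖γ‖ ≤ c1 * W * (Q : ℝ) ^ M :=
        (pi_norm_le_iff_of_nonneg (by positivity)).2 hcon
      have h2 : c1 * W * (Q : ℝ) ^ M ≤ c1 * W * y := by gcongr
      rw [hγx, hxy] at h1
      have h3 : 0 < c1 * W * y := by positivity
      nlinarith
    have h1 := H g hg Ct hCt Δ hΔ hΔn a b ha hb hab Q γ hQ1 hex
    have h2 : ‖OI a b (qq g γ)‖ ≤ c3 * ((Q : ℝ) ^ (M * (R + 1)))⁻¹ := by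
      refine le_of_pow_le_pow_left₀ (n := 2 ^ (e + 1)) (by positivity) (by positivity) (h1.trans ?_)
      rw [mul_pow, inv_pow, ← pow_mul, mul_comm (M * (R + 1))]
      refine mul_le_mul_of_nonneg_right ?_ (by positivity)
      exact (le_max_left _ _).trans (le_self_pow₀ hc31 (by positivity))
    have h3 : 1 + x ≤ (1 + 2 * c1) * 2 ^ M * (Q : ℝ) ^ M := by
      have : (1 + 2 * c1) * y ≤ (1 + 2 * c1) * (2 ^ M * (Q : ℝ) ^ M) := by gcongr
      rw [hxy]; linarith
    calc _ ≤ c3 * ((Q : ℝ) ^ (M * (R + 1)))⁻¹ * ((1 + 2 * c1) * 2 ^ M * (Q : ℝ) ^ M) ^ (R + 1) := by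
          gcongr
      _ = _ := by
          rw [mul_pow _ ((Q : ℝ) ^ M), ← pow_mul (Q : ℝ)]
          field_simp

end Decay2

lemma Iosc_eq {n R : ℕ} (g : Fin R → MvPolynomial (Fin n) ℤ) (a b : Fin n → ℝ) (γ : Fin R → ℝ) :
    Iosc g (boxSet a b) γ = OI a b (qq g γ) := by
  unfold Iosc OI boxSet qq
  rw [Set.pi_univ_Icc]
  congr 1
  funext x
  congr 1
  rw [map_sum]
  refine Finset.sum_congr rfl fun i _ => ?_
  rw [smul_eval, eval_map, aeval_def]
  rfl

lemma Iosc_cont {n R : ℕ} (g : Fin R → MvPolynomial (Fin n) ℤ) (a b : Fin n → ℝ) :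
    Continuous fun γ : Fin R → ℝ => Iosc g (boxSet a b) γ := by
  unfold Iosc boxSet
  rw [Set.pi_univ_Icc]
  refine continuous_parametric_integral_of_continuous (μ := (volume : Measure (Fin n → ℝ))) ?_
    isCompact_Icc
  refine continuous_eC.comp ?_
  refine continuous_finsetSum _ fun i _ => ?_
  refine Continuous.mul (by fun_prop) ?_
  have : ∀ z : Fin n → ℝ, aeval z (g i) = eval z (MvPolynomial.map (Int.castRingHom ℝ) (g i)) := by
    intro z; rw [eval_map, aeval_def]; rfl
  change Continuous fun p : (Fin R → ℝ) × (Fin n → ℝ) => aeval p.2 (g i)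
  simp_rw [this]
  exact (MvPolynomial.continuous_eval _).comp continuous_snd

theorem singular_integral_bound (n R d : ℕ) (hR : 0 < R) (hd : 2 ≤ d) (hnR : R < n)
    (η δ : ℝ) (hη : 0 < η) (hδ : 0 < δ) :
    ∃ c : ℝ, 0 < c ∧
      ∀ (f : Fin R → MvPolynomial (Fin n) ℤ),
        (∀ i, (f i).totalDegree = d) →
        ∀ (aB bB : Fin n → ℝ),
        (∀ j, -1 ≤ aB j ∧ 0 < bB j - aB j ∧ bB j - aB j < 1 ∧ bB j ≤ 1) →
        ∀ Ct K : ℝ, 1 ≤ Ct →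
        coeffMax (fun i => MvPolynomial.homogeneousComponent d (f i)) Ct →
        KofDelta n R d (fun i => MvPolynomial.homogeneousComponent d (f i)) K →
        δ / η < K / ((R : ℝ) * ((d : ℝ) - 1)) - ((R : ℝ) + 1) →
        ∀ μ : Fin R → ℝ,
          ‖Jlim (fun i => MvPolynomial.homogeneousComponent d (f i)) aB bB μ‖ ≤
            c * Ct ^ (R * (R - 1)) := by
  obtain ⟨e, rfl⟩ : ∃ e, d = e + 2 := ⟨d - 2, by omega⟩
  obtain ⟨c, hc0, H⟩ := osc_decay n R e (by omega) hR
  let h : (Fin R → ℝ) → ℝ := fun γ => ((1 + ‖γ‖) ^ (R + 1))⁻¹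
  have hInt : Integrable h := by
    have h1 := integrable_one_add_norm (E := Fin R → ℝ) (μ := volume) (r := (R : ℝ) + 1) (by simp)
    refine h1.congr (Eventually.of_forall fun γ => ?_)
    simp only [h]
    rw [Real.rpow_neg (by positivity)]
    congr 1
    exact_mod_cast Real.rpow_natCast (1 + ‖γ‖) (R + 1)
  have hh0 : 0 ≤ ∫ γ, h γ := integral_nonneg fun γ => by simp only [h]; positivity
  refine ⟨c * (∫ γ, h γ) + 1, by positivity, ?_⟩
  intro f hf aB bB hB Ct K hCt hmax hK hKb μ
  set g : Fin R → MvPolynomial (Fin n) ℤ := fun i => homogeneousComponent (e + 2) (f i) with hg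
  obtain ⟨Δ, hΔ, hKΔ⟩ := hK
  have hΔn : Δ + 2 ^ (e + 1) * (R * (e + 1) * (R + 1)) + 1 ≤ n := by
    have hR0 : (0 : ℝ) < R := by exact_mod_cast hR
    have h1 : (0 : ℝ) < δ / η := by positivity
    have h2 : (R : ℝ) + 1 < K / ((R : ℝ) * (((e + 2 : ℕ) : ℝ) - 1)) := by linarith
    have h3 : ((e + 2 : ℕ) : ℝ) - 1 = (e : ℝ) + 1 := by push_cast; ring
    rw [h3, lt_div_iff₀ (by positivity), hKΔ, lt_div_iff₀ (by positivity)] at h2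
    have h4 : e + 2 - 1 = e + 1 := rfl
    rw [h4] at h2
    have h5 : ((Δ + 2 ^ (e + 1) * (R * (e + 1) * (R + 1)) : ℕ) : ℝ) < (n : ℝ) := by
      push_cast; linarith
    have : Δ + 2 ^ (e + 1) * (R * (e + 1) * (R + 1)) < n := by exact_mod_cast h5
    omega
  have hdec : ∀ γ, ‖Iosc g (boxSet aB bB) γ‖ ≤ c * ((1 + ‖γ‖ / Ct ^ (R - 1)) ^ (R + 1))⁻¹ := by
    intro γ
    rw [Iosc_eq]
    exact H g (fun i => homogeneousComponent_isHomogeneous _ _) Ct hCt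
      (fun i α => hmax.2 ⟨i, α, rfl⟩) Δ hΔ.symm.le hΔn aB bB (fun j => (hB j).1)
      (fun j => (hB j).2.2.2) (fun j => by linarith [(hB j).2.1])
      (fun j => (hB j).2.2.1.le) γ
  set W := Ct ^ (R - 1) with hW
  have hW0 : 0 < W := by positivity
  let G : (Fin R → ℝ) → ℂ := fun γ => Iosc g (boxSet aB bB) γ * eC (-(∑ i, γ i * μ i))
  have hGc : Continuous G := by
    refine (Iosc_cont g aB bB).mul (continuous_eC.comp ?_)
    fun_prop
  have hbi : Integrable fun γ : Fin R → ℝ => c * h (W⁻¹ • γ) :=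
    (hInt.comp_smul (inv_ne_zero hW0.ne')).const_mul c
  have hGb : ∀ γ, ‖G γ‖ ≤ c * h (W⁻¹ • γ) := by
    intro γ
    simp only [G, h]
    rw [norm_mul, norm_eC, mul_one, norm_smul, Real.norm_of_nonneg (by positivity),
      ← div_eq_inv_mul]
    exact hdec γ
  have hGi : Integrable G :=
    hbi.mono' hGc.aestronglyMeasurable (Eventually.of_forall hGb)
  have hset : ∀ Φ : ℝ, 0 ≤ Φ → {γ : Fin R → ℝ | ∀ i, |γ i| ≤ Φ} = Metric.closedBall 0 Φ := by
    intro Φ hΦ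
    ext γ
    rw [Metric.mem_closedBall, dist_zero_right, pi_norm_le_iff_of_nonneg hΦ]
    rfl
  have hlim : Tendsto (fun Φ : ℝ => Jint g aB bB μ Φ) atTop (nhds (∫ γ, G γ)) := by
    have h1 := (aecover_closedBall (μ := (volume : Measure (Fin R → ℝ))) (x := 0)
      (tendsto_id (α := ℝ) (x := atTop))).integral_tendsto_of_countably_generated hGi
    refine h1.congr' ?_
    filter_upwards [eventually_ge_atTop (0 : ℝ)] with Φ hΦ
    unfold Jint
    rw [hset Φ hΦ]
    rfl
  have hJ : Jlim g aB bB μ = ∫ γ, G γ := hlim.limUnder_eq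
  rw [hJ]
  calc ‖∫ γ, G γ‖ ≤ ∫ γ, c * h (W⁻¹ • γ) :=
        norm_integral_le_of_norm_le hbi (Eventually.of_forall hGb)
    _ = c * (∫ γ, h γ) * Ct ^ (R * (R - 1)) := by
        rw [integral_const_mul, Measure.integral_comp_smul_of_nonneg volume h W⁻¹ (hR := by positivity)]
        rw [Module.finrank_fin_fun, inv_pow, inv_inv, smul_eq_mul, hW, ← pow_mul, mul_comm (R - 1)]
        ring
    _ ≤ _ := by
        refine mul_le_mul_of_nonneg_right (by linarith) (by positivity)

end
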